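/- arXiv:1507.01481 — 3 statements merged into one kernel-verified Lean document; each statement's English description precedes it below -/
import Mathlib

section
/- Let K be a convex body in ℝ² that is o-symmetric (K = −K, so o lies in the interior of K). Then |K|·|K*| ≥ 8, and equality holds if and only if K is a parallelogram (necessarily centred at o). -/
open MeasureTheory Pointwise Real
open scoped RealInnerProductSpace

/-- Area (two-dimensional Lebesgue measure) of a subset of the plane `ℂ ≅ ℝ²`. -/
noncomputable def area (K : Set ℂ) : ℝ := (volume K).toReal

/-- The polar body `K* = {x : ⟨x,y⟩ ≤ 1 for all y ∈ K}`. -/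
def polarBody (K : Set ℂ) : Set ℂ := {x | ∀ y ∈ K, ⟪x, y⟫ ≤ 1}

/-- A convex body: a compact convex set with nonempty interior. -/
def IsConvexBody (K : Set ℂ) : Prop := Convex ℝ K ∧ IsCompact K ∧ (interior K).Nonempty

/-- `K` is a parallelogram: the convex hull of `c ± u ± v` for linearly independent `u, v`. -/
def IsParallelogram (K : Set ℂ) : Prop :=
  ∃ c u v : ℂ, LinearIndependent ℝ ![u, v] ∧
    K = convexHull ℝ {c + u + v, c + u - v, c - u + v, c - u - v}

namespace PlanarMahler

section Area

theorem volume_preimage_linear {a b c d : ℝ} (h : a * d - b * c ≠ 0) (S : Set (ℝ × ℝ)) :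
    volume.real {x : ℝ × ℝ | (a * x.1 + b * x.2, c * x.1 + d * x.2) ∈ S} =
      |a * d - b * c|⁻¹ * volume.real S := by
  set f : ℝ × ℝ →ₗ[ℝ] ℝ × ℝ := Matrix.toLin (Module.Basis.finTwoProd ℝ)
    (Module.Basis.finTwoProd ℝ) !![a, b; c, d] with hf
  have hdet : LinearMap.det f = a * d - b * c := by
    rw [hf, LinearMap.det_toLin, Matrix.det_fin_two_of]
  have hset : {x : ℝ × ℝ | (a * x.1 + b * x.2, c * x.1 + d * x.2) ∈ S} = f ⁻¹' S := by
    ext x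
    rw [Set.mem_preimage, hf, Matrix.toLin_finTwoProd_apply]
    rfl
  rw [hset, measureReal_def,
    Measure.addHaar_preimage_linearMap volume (by rw [hdet]; exact h), hdet, ENNReal.toReal_mul,
    ENNReal.toReal_ofReal (abs_nonneg _), abs_inv, measureReal_def]

theorem volume_stdTriangle {d : ℝ} (hd : 0 ≤ d) :
    volume.real {x : ℝ × ℝ | 0 < x.1 ∧ 0 < x.2 ∧ x.1 + x.2 < d} = d ^ 2 / 2 := by
  have hset : {x : ℝ × ℝ | 0 < x.1 ∧ 0 < x.2 ∧ x.1 + x.2 < d} =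
      regionBetween (fun _ ↦ 0) (fun t ↦ d - t) (Set.Ioc 0 d) := by
    ext x
    simp only [regionBetween, Set.mem_ofPred_eq, Set.mem_Ioc, Set.mem_Ioo]
    constructor
    · rintro ⟨h1, h2, h3⟩
      exact ⟨⟨h1, by linarith⟩, h2, by linarith⟩
    · rintro ⟨⟨h1, -⟩, h2, h3⟩
      exact ⟨h1, h2, by linarith⟩
  have hint : ∫ t in Set.Ioc 0 d, ((fun t : ℝ ↦ d - t) - fun _ : ℝ ↦ (0 : ℝ)) t = d ^ 2 / 2 := by
    rw [← intervalIntegral.integral_of_le hd]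
    simp only [Pi.sub_apply, sub_zero]
    rw [intervalIntegral.integral_sub (by simp) (by simp)]
    simp
    ring
  rw [hset, measureReal_def, Measure.volume_eq_prod, volume_regionBetween_eq_integral, hint,
    ENNReal.toReal_ofReal (by positivity)]
  · exact (continuous_const.integrableOn_Icc (a := 0) (b := d)).mono_set Set.Ioc_subset_Icc_self
  · exact ((by fun_prop : Continuous fun t : ℝ ↦ d - t).integrableOn_Icc
      (a := 0) (b := d)).mono_set Set.Ioc_subset_Icc_self
  · exact measurableSet_Ioc
  · intro t ht
    simpa using ht.2

/-- The planar cross product. -/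
def cross (p q : ℝ × ℝ) : ℝ := p.1 * q.2 - p.2 * q.1

/-- The open triangle with vertices `0`, `p`, `q`, listed counterclockwise; it is empty when the
orientation is wrong. -/
def openTriangle (p q : ℝ × ℝ) : Set (ℝ × ℝ) :=
  {x | 0 < cross p x ∧ 0 < cross x q ∧ cross p x + cross x q < cross p q}

theorem isOpen_openTriangle (p q : ℝ × ℝ) : IsOpen (openTriangle p q) := by
  have h1 : Continuous fun x ↦ cross p x := by unfold cross; fun_prop
  have h2 : Continuous fun x ↦ cross x q := by unfold cross; fun_prop
  exact (isOpen_lt continuous_const h1).inter ((isOpen_lt continuous_const h2).inter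
    (isOpen_lt (h1.add h2) continuous_const))

theorem volume_openTriangle {p q : ℝ × ℝ} (h : 0 ≤ cross p q) :
    volume.real (openTriangle p q) = cross p q / 2 := by
  rcases h.eq_or_lt with h0 | h0
  · have : openTriangle p q = ∅ := by
      ext x
      simp only [openTriangle, Set.mem_ofPred_eq, Set.mem_empty_iff_false, iff_false]
      rintro ⟨h1, h2, h3⟩
      linarith
    rw [this, ← h0]
    simp
  · have hset : openTriangle p q = {x : ℝ × ℝ | (-p.2 * x.1 + p.1 * x.2, q.2 * x.1 + -q.1 * x.2) ∈
        {x : ℝ × ℝ | 0 < x.1 ∧ 0 < x.2 ∧ x.1 + x.2 < cross p q}} := by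
      ext x
      simp only [openTriangle, Set.mem_ofPred_eq]
      have e1 : cross p x = -p.2 * x.1 + p.1 * x.2 := by unfold cross; ring
      have e2 : cross x q = q.2 * x.1 + -q.1 * x.2 := by unfold cross; ring
      rw [e1, e2]
    have hdet : -p.2 * -q.1 - p.1 * q.2 = -cross p q := by unfold cross; ring
    rw [hset, volume_preimage_linear (by rw [hdet]; linarith), volume_stdTriangle h, hdet, abs_neg,
      abs_of_pos h0]
    field_simp

/-- The open first quadrant. -/
def quadrant : Set (ℝ × ℝ) := {x | 0 < x.1 ∧ 0 < x.2}

theorem isOpen_quadrant : IsOpen quadrant :=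
  (isOpen_lt continuous_const continuous_fst).inter (isOpen_lt continuous_const continuous_snd)

theorem openTriangle_subset_quadrant {p q : ℝ × ℝ} (hp : 0 ≤ p) (hq : 0 ≤ q) :
    openTriangle p q ⊆ quadrant := by
  rintro x ⟨h1, h2, h3⟩
  obtain ⟨hp1, hp2⟩ := hp
  obtain ⟨hq1, hq2⟩ := hq
  simp only [Prod.fst_zero, Prod.snd_zero] at hp1 hp2 hq1 hq2
  have hd : 0 < cross p q := by linarith
  have e1 : cross p q * x.1 = cross x q * p.1 + cross p x * q.1 := by unfold cross; ring
  have e2 : cross p q * x.2 = cross x q * p.2 + cross p x * q.2 := by unfold cross; ring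
  have hpq : 0 < p.1 * q.2 := by
    have := mul_nonneg hp2 hq1
    unfold cross at hd
    linarith
  have hp1' : 0 < p.1 := hp1.lt_of_ne fun h ↦ by simp [← h] at hpq
  have hq2' : 0 < q.2 := hq2.lt_of_ne fun h ↦ by simp [← h] at hpq
  exact ⟨pos_of_mul_pos_right (by rw [e1]; positivity) hd.le,
    pos_of_mul_pos_right (by rw [e2]; positivity) hd.le⟩

theorem openTriangle_subset_of_convex {C : Set (ℝ × ℝ)} (hC : Convex ℝ C) (h0 : 0 ∈ C)
    {p q : ℝ × ℝ} (hp : p ∈ C) (hq : q ∈ C) : openTriangle p q ⊆ C := by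
  rintro x ⟨h1, h2, h3⟩
  have hd : 0 < cross p q := by linarith
  have hs : 0 < cross p x + cross x q := by linarith
  have key := hC.smul_mem_of_zero_mem h0
    (hC hp hq (a := cross x q / (cross p x + cross x q)) (b := cross p x / (cross p x + cross x q))
      (by positivity) (by positivity) (by field_simp; ring))
    (t := (cross p x + cross x q) / cross p q)
    ⟨by positivity, by rw [div_le_one hd]; exact h3.le⟩
  convert key using 1
  rw [smul_add, smul_smul, smul_smul]
  have e1 : (cross p x + cross x q) / cross p q * (cross x q / (cross p x + cross x q)) =
    cross x q / cross p q := by field_simp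
  have e2 : (cross p x + cross x q) / cross p q * (cross p x / (cross p x + cross x q)) =
    cross p x / cross p q := by field_simp
  rw [e1, e2]
  ext
  · simp only [Prod.fst_add, Prod.smul_fst, smul_eq_mul]
    field_simp
    unfold cross; ring
  · simp only [Prod.snd_add, Prod.smul_snd, smul_eq_mul]
    field_simp
    unfold cross; ring

/-- A convex set containing the pentagon with vertices `0`, `(1, 0)`, `z`, `w`, `(0, 1)` has at
least its area in the first quadrant. -/
theorem le_volume_inter_quadrant {C : Set (ℝ × ℝ)} (hC : Convex ℝ C) (h0 : 0 ∈ C)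
    (h1 : (1, 0) ∈ C) (h2 : (0, 1) ∈ C) {z w : ℝ × ℝ} (hz : z ∈ C) (hw : w ∈ C) (hz0 : 0 ≤ z)
    (hw0 : 0 ≤ w) (hzw : 0 ≤ cross z w) (hfin : volume C ≠ ⊤) :
    (z.2 + cross z w + w.1) / 2 ≤ volume.real (C ∩ quadrant) := by
  have hz1 : 0 ≤ z.1 := hz0.1
  have hz2 : 0 ≤ z.2 := hz0.2
  have hw1 : 0 ≤ w.1 := hw0.1
  have hw2 : 0 ≤ w.2 := hw0.2
  have p1 : (0 : ℝ × ℝ) ≤ (1, 0) := ⟨zero_le_one, le_rfl⟩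
  have p2 : (0 : ℝ × ℝ) ≤ (0, 1) := ⟨le_rfl, zero_le_one⟩
  have s1 : openTriangle (1, 0) z ⊆ C ∩ quadrant := Set.subset_inter
    (openTriangle_subset_of_convex hC h0 h1 hz) (openTriangle_subset_quadrant p1 hz0)
  have s2 : openTriangle z w ⊆ C ∩ quadrant := Set.subset_inter
    (openTriangle_subset_of_convex hC h0 hz hw) (openTriangle_subset_quadrant hz0 hw0)
  have s3 : openTriangle w (0, 1) ⊆ C ∩ quadrant := Set.subset_inter
    (openTriangle_subset_of_convex hC h0 hw h2) (openTriangle_subset_quadrant hw0 p2)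
  have hfin' : volume (C ∩ quadrant) ≠ ⊤ := measure_ne_top_of_subset Set.inter_subset_left hfin
  have d12 : Disjoint (openTriangle (1, 0) z) (openTriangle z w) := by
    rw [Set.disjoint_left]
    rintro x ⟨-, h, -⟩ ⟨h', -, -⟩
    unfold cross at h h'
    linarith
  have d23 : Disjoint (openTriangle z w) (openTriangle w (0, 1)) := by
    rw [Set.disjoint_left]
    rintro x ⟨-, h, -⟩ ⟨h', -, -⟩
    unfold cross at h h'
    linarith
  have d13 : Disjoint (openTriangle (1, 0) z) (openTriangle w (0, 1)) := by
    rw [Set.disjoint_left]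
    intro x hx hx'
    obtain ⟨hx1, hx2⟩ := (s1 hx).2
    obtain ⟨-, h, -⟩ := hx
    obtain ⟨h', -, -⟩ := hx'
    unfold cross at h h' hzw
    have hw1' : 0 < w.1 := by
      by_contra hcon
      have : w.1 = 0 := le_antisymm (not_lt.1 hcon) hw1
      rw [this] at h'
      nlinarith [mul_nonneg hw2 hx1.le]
    have hz2' : 0 < z.2 := by
      by_contra hcon
      have : z.2 = 0 := le_antisymm (not_lt.1 hcon) hz2
      rw [this] at h
      nlinarith [mul_nonneg hx2.le hz1]
    nlinarith [mul_pos (mul_pos hx2 hw1') (show 0 < x.1 * z.2 - x.2 * z.1 from h),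
      mul_nonneg (mul_nonneg hx2.le hz1) h'.le,
      mul_pos (mul_pos hx1 hz2') (show 0 < w.1 * x.2 - w.2 * x.1 from h'),
      mul_nonneg (mul_nonneg hx1.le hx2.le) hzw]
  have e1 : cross (1, 0) z = z.2 := by simp [cross]
  have e3 : cross w (0, 1) = w.1 := by simp [cross]
  have hU : openTriangle (1, 0) z ∪ openTriangle z w ∪ openTriangle w (0, 1) ⊆ C ∩ quadrant :=
    Set.union_subset (Set.union_subset s1 s2) s3
  have hle := measureReal_mono hU hfin'
  rw [measureReal_union (Set.disjoint_union_left.2 ⟨d13, d23⟩)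
      (isOpen_openTriangle _ _).measurableSet
      (measure_ne_top_of_subset (Set.union_subset s1 s2) hfin')
      (measure_ne_top_of_subset s3 hfin'),
    measureReal_union d12 (isOpen_openTriangle _ _).measurableSet
      (measure_ne_top_of_subset s1 hfin') (measure_ne_top_of_subset s2 hfin'),
    volume_openTriangle (by rw [e1]; exact hz2), volume_openTriangle hzw,
    volume_openTriangle (by rw [e3]; exact hw1), e1, e3] at hle
  linarith

/-- The mirror image of a set in the vertical axis. -/
def mirror (A : Set (ℝ × ℝ)) : Set (ℝ × ℝ) := {x | (-x.1, x.2) ∈ A}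

theorem volume_mirror (A : Set (ℝ × ℝ)) : volume.real (mirror A) = volume.real A := by
  have h := volume_preimage_linear (a := -1) (b := 0) (c := 0) (d := 1) (by norm_num) A
  norm_num at h
  exact h

theorem volume_horizontal : volume {x : ℝ × ℝ | x.2 = 0} = 0 := by
  have : {x : ℝ × ℝ | x.2 = 0} = Set.univ ×ˢ {0} := by ext; simp
  rw [this, Measure.volume_eq_prod, Measure.prod_prod]
  simp

theorem volume_vertical : volume {x : ℝ × ℝ | x.1 = 0} = 0 := by
  have : {x : ℝ × ℝ | x.1 = 0} = {0} ×ˢ Set.univ := by ext; simp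
  rw [this, Measure.volume_eq_prod, Measure.prod_prod]
  simp

/-- The area of a centrally symmetric set, computed from two quadrants. -/
theorem volume_eq_two_mul_quadrants {A : Set (ℝ × ℝ)} (hsym : ∀ x ∈ A, -x ∈ A)
    (hfin : volume A ≠ ⊤) :
    volume.real A = 2 * (volume.real (A ∩ quadrant) + volume.real (mirror A ∩ quadrant)) := by
  have hup : MeasurableSet {x : ℝ × ℝ | 0 < x.2} := measurableSet_lt measurable_const measurable_snd
  have hright : MeasurableSet {x : ℝ × ℝ | 0 < x.1} :=
    measurableSet_lt measurable_const measurable_fst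
  have hU : volume (A ∩ {x | 0 < x.2}) ≠ ⊤ :=
    measure_ne_top_of_subset Set.inter_subset_left hfin
  have hae2 : ∀ᵐ x : ℝ × ℝ, x.2 ≠ 0 := by
    rw [ae_iff]; simpa using volume_horizontal
  have hae1 : ∀ᵐ x : ℝ × ℝ, x.1 ≠ 0 := by
    rw [ae_iff]; simpa using volume_vertical
  have hlow : volume.real (A \ {x | 0 < x.2}) = volume.real (A ∩ {x | 0 < x.2}) := by
    have h := volume_preimage_linear (a := -1) (b := 0) (c := 0) (d := -1) (by norm_num)
      (A ∩ {x | 0 < x.2})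
    norm_num at h
    rw [← h]
    refine measureReal_congr ?_
    filter_upwards [hae2] with x hx
    refine propext ⟨?_, ?_⟩
    · rintro ⟨hxA, hx'⟩
      exact ⟨hsym x hxA, by
        simp only [Set.mem_ofPred_eq, not_lt] at hx'
        simpa using lt_of_le_of_ne hx' hx⟩
    · rintro ⟨hxA, hx'⟩
      refine ⟨by simpa using hsym _ hxA, ?_⟩
      have : x.2 < 0 := hx'
      simp only [Set.mem_ofPred_eq, not_lt]
      linarith
  have hQ : A ∩ {x | 0 < x.2} ∩ {x | 0 < x.1} = A ∩ quadrant := by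
    ext x
    simp only [quadrant, Set.mem_inter_iff, Set.mem_ofPred_eq]
    tauto
  have hM : volume.real ((A ∩ {x | 0 < x.2}) \ {x | 0 < x.1}) =
      volume.real (mirror A ∩ quadrant) := by
    rw [← volume_mirror (mirror A ∩ quadrant)]
    refine measureReal_congr ?_
    filter_upwards [hae1] with x hx
    refine propext ⟨?_, ?_⟩
    · rintro ⟨⟨hxA, hx2⟩, hx'⟩
      simp only [Set.mem_ofPred_eq, not_lt] at hx'
      refine ⟨by simpa [mirror] using hxA, ?_, hx2⟩
      simpa using lt_of_le_of_ne hx' hx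
    · rintro ⟨hxA, hx1, hx2⟩
      refine ⟨⟨by simpa [mirror] using hxA, hx2⟩, ?_⟩
      have : 0 < -x.1 := hx1
      simp only [Set.mem_ofPred_eq, not_lt]
      linarith
  have t1 := measureReal_inter_add_sdiff (μ := volume) (s := A) hup hfin
  have t2 := measureReal_inter_add_sdiff (μ := volume) (s := A ∩ {x | 0 < x.2}) hright hU
  rw [hQ, hM] at t2
  rw [hlow] at t1
  linarith

end Area

section Auerbach

/-- The polar of a subset of `ℝ × ℝ` with respect to the standard pairing. -/
def dualSet (A : Set (ℝ × ℝ)) : Set (ℝ × ℝ) := {y | ∀ x ∈ A, x.1 * y.1 + x.2 * y.2 ≤ 1}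

theorem dualSet_mirror (A : Set (ℝ × ℝ)) : dualSet (mirror A) = mirror (dualSet A) := by
  ext y
  constructor
  · intro h x hx
    have := h (-x.1, x.2) (by simpa [mirror] using hx)
    simp only at this ⊢
    linarith
  · intro h x hx
    have := h (-x.1, x.2) hx
    simp only at this ⊢
    linarith

/-- A closed convex centrally symmetric set for which the standard basis is an Auerbach basis. -/
structure IsAuerbach (A : Set (ℝ × ℝ)) : Prop where
  convex : Convex ℝ A
  isClosed : IsClosed A
  neg_mem : ∀ x ∈ A, -x ∈ A
  e₁_mem : (1, 0) ∈ A
  e₂_mem : (0, 1) ∈ A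
  le_one : ∀ x ∈ A, x.1 ≤ 1 ∧ x.2 ≤ 1

namespace IsAuerbach

variable {A : Set (ℝ × ℝ)}

theorem neg_one_le (h : IsAuerbach A) {x : ℝ × ℝ} (hx : x ∈ A) : -1 ≤ x.1 ∧ -1 ≤ x.2 := by
  have := h.le_one _ (h.neg_mem x hx)
  simp only [Prod.fst_neg, Prod.snd_neg] at this
  constructor <;> linarith

theorem zero_mem (h : IsAuerbach A) : 0 ∈ A := by
  have := h.convex h.e₁_mem (h.neg_mem _ h.e₁_mem) (a := 1 / 2) (b := 1 / 2) (by norm_num)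
    (by norm_num) (by norm_num)
  convert this using 1
  ext <;> simp

theorem subset_Icc (h : IsAuerbach A) : A ⊆ Set.Icc (-1, -1) (1, 1) := fun x hx ↦
  ⟨⟨(h.neg_one_le hx).1, (h.neg_one_le hx).2⟩, ⟨(h.le_one x hx).1, (h.le_one x hx).2⟩⟩

theorem volume_ne_top (h : IsAuerbach A) : volume A ≠ ⊤ :=
  measure_ne_top_of_subset h.subset_Icc isCompact_Icc.measure_lt_top.ne

theorem mirror (h : IsAuerbach A) : IsAuerbach (mirror A) where
  convex := by
    intro x hx y hy a b ha hb hab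
    have := h.convex hx hy ha hb hab
    change (_, _) ∈ A
    convert this using 2
    · simp
      ring
    · simp
  isClosed := h.isClosed.preimage (by fun_prop : Continuous fun x : ℝ × ℝ ↦ (-x.1, x.2))
  neg_mem x hx := by
    have := h.neg_mem _ hx
    exact this
  e₁_mem := by
    have := h.neg_mem _ h.e₁_mem
    simpa [PlanarMahler.mirror] using this
  e₂_mem := by simpa [PlanarMahler.mirror] using h.e₂_mem
  le_one x hx := by
    have h1 := h.neg_one_le hx
    have h2 := h.le_one _ hx
    simp only at h1 h2
    constructor <;> linarith

theorem dualSet (h : IsAuerbach A) : IsAuerbach (dualSet A) where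
  convex := by
    intro x hx y hy a b ha hb hab z hz
    have h1 := mul_le_mul_of_nonneg_left (hx z hz) ha
    have h2 := mul_le_mul_of_nonneg_left (hy z hz) hb
    simp only [Prod.fst_add, Prod.snd_add, Prod.smul_fst, Prod.smul_snd, smul_eq_mul]
    linarith
  isClosed := by
    have : PlanarMahler.dualSet A = ⋂ x ∈ A, {y : ℝ × ℝ | x.1 * y.1 + x.2 * y.2 ≤ 1} := by
      ext y
      simp [PlanarMahler.dualSet]
    rw [this]
    exact isClosed_biInter fun x _ ↦ isClosed_le (by fun_prop) continuous_const
  neg_mem y hy x hx := by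
    have := hy _ (h.neg_mem x hx)
    simp only [Prod.fst_neg, Prod.snd_neg] at this ⊢
    linarith
  e₁_mem x hx := by simpa using (h.le_one x hx).1
  e₂_mem x hx := by simpa using (h.le_one x hx).2
  le_one y hy := by
    have h1 := hy _ h.e₁_mem
    have h2 := hy _ h.e₂_mem
    simp only at h1 h2
    constructor <;> linarith

theorem dualSet_dualSet (h : IsAuerbach A) :
    PlanarMahler.dualSet (PlanarMahler.dualSet A) = A := by
  refine Set.Subset.antisymm (fun z hz ↦ ?_) (fun x hx y hy ↦ ?_)
  · by_contra hzA
    obtain ⟨f, u, hf, hu⟩ := geometric_hahn_banach_closed_point h.convex h.isClosed hzA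
    have hu0 : 0 < u := by simpa using hf 0 h.zero_mem
    have hfx (x : ℝ × ℝ) : f x = x.1 * f (1, 0) + x.2 * f (0, 1) := by
      have : x = x.1 • ((1, 0) : ℝ × ℝ) + x.2 • ((0, 1) : ℝ × ℝ) := by ext <;> simp
      conv_lhs => rw [this]
      simp only [map_add, map_smul, smul_eq_mul]
    have hmem : (f (1, 0) / u, f (0, 1) / u) ∈ PlanarMahler.dualSet A := by
      intro x hx
      have := (hf x hx).le
      rw [hfx] at this
      have e : x.1 * (f (1, 0) / u) + x.2 * (f (0, 1) / u) =
        (x.1 * f (1, 0) + x.2 * f (0, 1)) / u := by ring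
      simp only [e]
      rwa [div_le_one hu0]
    have h1 := hz _ hmem
    rw [hfx] at hu
    have e : f (1, 0) / u * z.1 + f (0, 1) / u * z.2 =
      (z.1 * f (1, 0) + z.2 * f (0, 1)) / u := by ring
    simp only [e] at h1
    rw [div_le_one hu0] at h1
    linarith
  · have := hy x hx
    linarith

theorem add_le_two_mul_volume (h : IsAuerbach A) {x : ℝ × ℝ} (hx : x ∈ A) (hx0 : 0 ≤ x) :
    x.1 + x.2 ≤ 2 * volume.real (A ∩ quadrant) := by
  have := le_volume_inter_quadrant h.convex h.zero_mem h.e₁_mem h.e₂_mem hx hx hx0 hx0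
    (by unfold cross; linarith) h.volume_ne_top
  unfold cross at this
  linarith

theorem one_le_two_mul_volume (h : IsAuerbach A) : 1 ≤ 2 * volume.real (A ∩ quadrant) := by
  simpa using h.add_le_two_mul_volume h.e₁_mem ⟨zero_le_one, le_rfl⟩

theorem diagonal_mem_dualSet (h : IsAuerbach A) :
    (1 / (2 * volume.real (A ∩ quadrant)), 1 / (2 * volume.real (A ∩ quadrant))) ∈
      PlanarMahler.dualSet A := by
  intro x hx
  have h1 := h.one_le_two_mul_volume
  set p := volume.real (A ∩ quadrant) with hp
  have key : x.1 + x.2 ≤ 2 * p := by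
    obtain ⟨hx1, hx2⟩ := h.le_one x hx
    by_cases c1 : 0 ≤ x.1
    · by_cases c2 : 0 ≤ x.2
      · exact h.add_le_two_mul_volume hx ⟨c1, c2⟩
      · linarith
    · linarith
  have e : x.1 * (1 / (2 * p)) + x.2 * (1 / (2 * p)) = (x.1 + x.2) / (2 * p) := by ring
  simp only [e]
  rwa [div_le_one (by linarith)]

theorem quadrant_product (h : IsAuerbach A) :
    1 / 2 ≤ volume.real (A ∩ quadrant) * volume.real (PlanarMahler.dualSet A ∩ quadrant) := by
  have h1 := h.one_le_two_mul_volume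
  have hp : 0 < volume.real (A ∩ quadrant) := by linarith
  have h2 := h.dualSet.add_le_two_mul_volume h.diagonal_mem_dualSet
    ⟨by simp only [Prod.fst_zero]; positivity, by simp only [Prod.snd_zero]; positivity⟩
  simp only at h2
  have e : volume.real (A ∩ quadrant) * (1 / (2 * volume.real (A ∩ quadrant))) = 1 / 2 := by
    field_simp
  have := mul_le_mul_of_nonneg_left h2 hp.le
  linarith

theorem volume_mul_volume_dualSet (h : IsAuerbach A) :
    volume.real A * volume.real (PlanarMahler.dualSet A) =
      4 * ((volume.real (A ∩ quadrant) + volume.real (PlanarMahler.mirror A ∩ quadrant)) *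
        (volume.real (PlanarMahler.dualSet A ∩ quadrant) +
          volume.real (PlanarMahler.dualSet (PlanarMahler.mirror A) ∩ quadrant))) := by
  rw [volume_eq_two_mul_quadrants h.neg_mem h.volume_ne_top,
    volume_eq_two_mul_quadrants h.dualSet.neg_mem h.dualSet.volume_ne_top, dualSet_mirror]
  ring

theorem add_mul_add_ge {p p' q q' : ℝ} (hp : 0 < p) (hp' : 0 < p') (h : 1 / 2 ≤ p * q)
    (h' : 1 / 2 ≤ p' * q') :
    2 ≤ (p + p') * (q + q') ∧
      ((p + p') * (q + q') = 2 → p = p' ∧ p * q = 1 / 2 ∧ p' * q' = 1 / 2) := by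
  have hpp : 0 < p * p' := mul_pos hp hp'
  have e : p * p' * ((p + p') * (q + q') - 2) =
      (p * q - 1 / 2) * (p * p' + p' ^ 2) + (p' * q' - 1 / 2) * (p * p' + p ^ 2) +
        (p - p') ^ 2 / 2 := by ring
  have t1 : 0 ≤ (p * q - 1 / 2) * (p * p' + p' ^ 2) :=
    mul_nonneg (by linarith) (by positivity)
  have t2 : 0 ≤ (p' * q' - 1 / 2) * (p * p' + p ^ 2) :=
    mul_nonneg (by linarith) (by positivity)
  have t3 : 0 ≤ (p - p') ^ 2 / 2 := by positivity
  refine ⟨?_, fun heq ↦ ?_⟩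
  · have : 0 ≤ (p + p') * (q + q') - 2 :=
      nonneg_of_mul_nonneg_right (by rw [e]; linarith) hpp
    linarith
  · rw [heq, sub_self, mul_zero] at e
    have z1 : (p * q - 1 / 2) * (p * p' + p' ^ 2) = 0 := by linarith
    have z2 : (p' * q' - 1 / 2) * (p * p' + p ^ 2) = 0 := by linarith
    have z3 : (p - p') ^ 2 = 0 := by linarith
    refine ⟨sub_eq_zero.1 (pow_eq_zero_iff two_ne_zero |>.1 z3),
      sub_eq_zero.1 ((mul_eq_zero.1 z1).resolve_right (by positivity)),
      sub_eq_zero.1 ((mul_eq_zero.1 z2).resolve_right (by positivity))⟩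

theorem eight_le (h : IsAuerbach A) :
    8 ≤ volume.real A * volume.real (PlanarMahler.dualSet A) := by
  have h1 := h.one_le_two_mul_volume
  have h2 := h.mirror.one_le_two_mul_volume
  have := (add_mul_add_ge (by linarith) (by linarith) h.quadrant_product
    h.mirror.quadrant_product).1
  rw [h.volume_mul_volume_dualSet]
  linarith

/-- If the quadrant inequality is an equality then the diagonal point of `A` is extremal. -/
theorem diagonal_mem (h : IsAuerbach A)
    (heq : volume.real (A ∩ quadrant) * volume.real (PlanarMahler.dualSet A ∩ quadrant) = 1 / 2) :
    (volume.real (A ∩ quadrant), volume.real (A ∩ quadrant)) ∈ A := by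
  have h1 := h.dualSet.diagonal_mem_dualSet
  rw [h.dualSet_dualSet] at h1
  have hq := h.dualSet.one_le_two_mul_volume
  have e : 1 / (2 * volume.real (PlanarMahler.dualSet A ∩ quadrant)) =
      volume.real (A ∩ quadrant) := by
    rw [div_eq_iff (by linarith)]
    linarith
  rwa [e] at h1

theorem volume_eq_half_or_one (h : IsAuerbach A)
    (heq : volume.real (A ∩ quadrant) * volume.real (PlanarMahler.dualSet A ∩ quadrant) = 1 / 2) :
    volume.real (A ∩ quadrant) = 1 / 2 ∨ volume.real (A ∩ quadrant) = 1 := by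
  have hdiag := h.diagonal_mem heq
  have hhalf := h.one_le_two_mul_volume
  have hm := h.diagonal_mem_dualSet
  set a := volume.real (A ∩ quadrant) with ha
  set q := volume.real (PlanarMahler.dualSet A ∩ quadrant) with hq
  have ha1 : a ≤ 1 := (h.le_one _ hdiag).1
  by_contra! hcon
  have ha2 : 1 / 2 < a := lt_of_le_of_ne (by linarith) (Ne.symm hcon.1)
  have ha3 : a < 1 := lt_of_le_of_ne ha1 hcon.2
  have hc : (1 - a) / a ≤ 1 := by rw [div_le_one (by linarith)]; linarith
  have hc0 : 0 ≤ (1 - a) / a := div_nonneg (by linarith) (by linarith)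
  have hmem : (1, (1 - a) / a) ∈ PlanarMahler.dualSet A := by
    intro x hx
    obtain ⟨hx1, hx2⟩ := h.le_one x hx
    simp only [mul_one]
    by_cases c2 : 0 ≤ x.2
    · by_cases c1 : 0 ≤ x.1
      · suffices a * x.1 + (1 - a) * x.2 ≤ a by
          have e : x.1 + x.2 * ((1 - a) / a) = (a * x.1 + (1 - a) * x.2) / a := by field_simp
          rwa [e, div_le_one (by linarith)]
        rcases le_total x.2 x.1 with hle | hle
        · have := le_volume_inter_quadrant h.convex h.zero_mem h.e₁_mem h.e₂_mem hx hdiag ⟨c1, c2⟩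
            ⟨by simp only [Prod.fst_zero]; linarith, by simp only [Prod.snd_zero]; linarith⟩
            (by unfold cross; nlinarith) h.volume_ne_top
          unfold cross at this
          simp only at this
          linarith
        · have := h.add_le_two_mul_volume hx ⟨c1, c2⟩
          nlinarith
      · nlinarith
    · nlinarith
  set m := 1 / (2 * a) with hmdef
  have hm0 : 0 < m := by positivity
  have hma : m * a = 1 / 2 := by rw [hmdef]; field_simp
  have hcm : (1 - a) / a = 2 * m - 1 := by rw [hmdef]; field_simp
  rw [hcm] at hmem hc hc0
  have hqm : q = m := by
    have : a * (q - m) = 0 := by linarith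
    rcases mul_eq_zero.1 this with h0 | h0 <;> linarith
  have hfinal := le_volume_inter_quadrant h.dualSet.convex h.dualSet.zero_mem h.dualSet.e₁_mem
    h.dualSet.e₂_mem hmem hm ⟨zero_le_one, hc0⟩ ⟨hm0.le, hm0.le⟩
    (by unfold cross; simp only; nlinarith) h.dualSet.volume_ne_top
  rw [← hq, hqm] at hfinal
  unfold cross at hfinal
  simp only at hfinal
  have hm1 : 1 / 2 < m := by nlinarith
  have hm2 : m < 1 := by nlinarith
  nlinarith [mul_pos (sub_pos.2 hm1) (sub_pos.2 hm2)]

/-- The equality case: the body is a square or a cross-polytope. -/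
theorem eq_square_or_eq_cross_polytope (h : IsAuerbach A)
    (heq : volume.real A * volume.real (PlanarMahler.dualSet A) = 8) :
    A = {x | |x.1| ≤ 1 ∧ |x.2| ≤ 1} ∨ A = {x | |x.1| + |x.2| ≤ 1} := by
  have h1 := h.one_le_two_mul_volume
  have h2 := h.mirror.one_le_two_mul_volume
  rw [h.volume_mul_volume_dualSet] at heq
  obtain ⟨hpp, hpq, hpq'⟩ := (add_mul_add_ge (by linarith) (by linarith) h.quadrant_product
    h.mirror.quadrant_product).2 (by linarith)
  rcases h.volume_eq_half_or_one hpq with hp | hp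
  · right
    have hd := h.diagonal_mem_dualSet
    have hd' := h.mirror.diagonal_mem_dualSet
    rw [← hpp, hp] at hd'
    rw [hp] at hd
    norm_num at hd hd'
    have hle : ∀ x ∈ A, x.1 + x.2 ≤ 1 ∧ -x.1 + x.2 ≤ 1 := by
      intro x hx
      have t1 := hd x hx
      have t2 := hd' (-x.1, x.2) (by simpa [PlanarMahler.mirror] using hx)
      simp only [mul_one] at t1 t2
      exact ⟨t1, t2⟩
    ext x
    constructor
    · intro hx
      have t1 := hle x hx
      have t2 := hle _ (h.neg_mem x hx)
      simp only [Prod.fst_neg, Prod.snd_neg] at t2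
      change |x.1| + |x.2| ≤ 1
      rcases abs_cases x.1 with c | c <;> rcases abs_cases x.2 with d | d <;> linarith
    · intro hx
      have hx' : |x.1| + |x.2| ≤ 1 := hx
      have aux (e : ℝ × ℝ) (he : e ∈ A) (t : ℝ) (ht : |t| ≤ 1) : t • e ∈ A := by
        rcases abs_cases t with ⟨c, c'⟩ | ⟨c, c'⟩
        · exact h.convex.smul_mem_of_zero_mem h.zero_mem he ⟨c', by linarith⟩
        · have := h.convex.smul_mem_of_zero_mem h.zero_mem (h.neg_mem e he) (t := -t)
            ⟨by linarith, by linarith⟩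
          simpa using this
      rcases (abs_nonneg x.1).eq_or_lt with hz | hz
      · have hx0 : x.1 = 0 := abs_eq_zero.1 hz.symm
        have := aux _ h.e₂_mem x.2 (by linarith [abs_nonneg x.1])
        convert this using 1
        ext <;> simp [hx0]
      rcases (abs_nonneg x.2).eq_or_lt with hw | hw
      · have hx0 : x.2 = 0 := abs_eq_zero.1 hw.symm
        have := aux _ h.e₁_mem x.1 (by linarith)
        convert this using 1
        ext <;> simp [hx0]
      have hs : 0 < |x.1| + |x.2| := by positivity
      have m1 := aux _ h.e₁_mem (x.1 / |x.1| * (|x.1| + |x.2|))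
        (by rw [abs_mul, abs_div, abs_abs, div_self hz.ne', abs_of_pos hs]; linarith)
      have m2 := aux _ h.e₂_mem (x.2 / |x.2| * (|x.1| + |x.2|))
        (by rw [abs_mul, abs_div, abs_abs, div_self hw.ne', abs_of_pos hs]; linarith)
      have := h.convex m1 m2 (a := |x.1| / (|x.1| + |x.2|)) (b := |x.2| / (|x.1| + |x.2|))
        (by positivity) (by positivity) (by field_simp)
      convert this using 1
      ext
      · simp; field_simp
      · simp; field_simp
  · left
    have m1 := h.diagonal_mem hpq
    have m2 := h.mirror.diagonal_mem hpq'
    rw [← hpp, hp] at m2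
    rw [hp] at m1
    change (-1, 1) ∈ A at m2
    have m3 := h.neg_mem _ m1
    have m4 := h.neg_mem _ m2
    norm_num at m3 m4
    ext x
    constructor
    · intro hx
      obtain ⟨t1, t2⟩ := h.le_one x hx
      obtain ⟨t3, t4⟩ := h.neg_one_le hx
      exact ⟨abs_le.2 ⟨t3, t1⟩, abs_le.2 ⟨t4, t2⟩⟩
    · rintro ⟨hx1, hx2⟩
      obtain ⟨t3, t1⟩ := abs_le.1 hx1
      obtain ⟨t4, t2⟩ := abs_le.1 hx2
      have r := h.convex m1 m4 (a := (1 + x.2) / 2) (b := (1 - x.2) / 2) (by linarith)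
        (by linarith) (by ring)
      have l := h.convex m2 m3 (a := (1 + x.2) / 2) (b := (1 - x.2) / 2) (by linarith)
        (by linarith) (by ring)
      have := h.convex r l (a := (1 + x.1) / 2) (b := (1 - x.1) / 2) (by linarith)
        (by linarith) (by ring)
      convert this using 1
      ext
      · simp; ring
      · simp; ring

end IsAuerbach

end Auerbach

section Square

theorem isAuerbach_square : IsAuerbach {x | |x.1| ≤ 1 ∧ |x.2| ≤ 1} where
  convex := by
    rintro x ⟨hx1, hx2⟩ y ⟨hy1, hy2⟩ a b ha hb hab
    rw [abs_le] at hx1 hx2 hy1 hy2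
    refine ⟨abs_le.2 ⟨?_, ?_⟩, abs_le.2 ⟨?_, ?_⟩⟩ <;> simp <;> nlinarith
  isClosed := (isClosed_le (continuous_abs.comp continuous_fst) continuous_const).inter
    (isClosed_le (continuous_abs.comp continuous_snd) continuous_const)
  neg_mem x hx := by simpa using hx
  e₁_mem := by simp
  e₂_mem := by simp
  le_one x hx := ⟨(abs_le.1 hx.1).2, (abs_le.1 hx.2).2⟩

theorem volume_square_mul_volume_dualSet_le :
    volume.real {x : ℝ × ℝ | |x.1| ≤ 1 ∧ |x.2| ≤ 1} *
      volume.real (dualSet {x : ℝ × ℝ | |x.1| ≤ 1 ∧ |x.2| ≤ 1}) ≤ 8 := by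
  have hA := isAuerbach_square
  have hmir : mirror {x : ℝ × ℝ | |x.1| ≤ 1 ∧ |x.2| ≤ 1} = {x | |x.1| ≤ 1 ∧ |x.2| ≤ 1} := by
    ext x
    simp [mirror]
  set A : Set (ℝ × ℝ) := {x : ℝ × ℝ | |x.1| ≤ 1 ∧ |x.2| ≤ 1} with hAdef
  have hp : volume.real (A ∩ quadrant) ≤ 1 := by
    have hsub : A ∩ quadrant ⊆ Set.Icc 0 1 ×ˢ Set.Icc 0 1 := by
      rintro x ⟨hx, hx1, hx2⟩
      exact ⟨⟨hx1.le, (hA.le_one x hx).1⟩, ⟨hx2.le, (hA.le_one x hx).2⟩⟩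
    refine (measureReal_mono hsub ((isCompact_Icc.prod isCompact_Icc).measure_lt_top.ne)).trans ?_
    rw [measureReal_def, Measure.volume_eq_prod, Measure.prod_prod]
    simp
  have hq : volume.real (dualSet A ∩ quadrant) ≤ 1 / 2 := by
    refine le_of_forall_pos_le_add fun ε hε ↦ ?_
    have hd : (1 : ℝ) < √(1 + 2 * ε) := by
      rw [Real.lt_sqrt (by norm_num)]
      linarith
    have hT := volume_stdTriangle (d := √(1 + 2 * ε)) (by positivity)
    rw [Real.sq_sqrt (by positivity)] at hT
    have hsub : dualSet A ∩ quadrant ⊆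
        {x : ℝ × ℝ | 0 < x.1 ∧ 0 < x.2 ∧ x.1 + x.2 < √(1 + 2 * ε)} := by
      rintro x ⟨hx, hx1, hx2⟩
      have := hx (1, 1) (by simp [hAdef])
      simp only [one_mul] at this
      exact ⟨hx1, hx2, by linarith⟩
    have hfin : volume {x : ℝ × ℝ | 0 < x.1 ∧ 0 < x.2 ∧ x.1 + x.2 < √(1 + 2 * ε)} ≠ ⊤ := by
      intro htop
      rw [measureReal_def, htop] at hT
      simp only [ENNReal.toReal_top] at hT
      linarith
    have := measureReal_mono hsub hfin
    rw [hT] at this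
    linarith
  have hp0 : 0 ≤ volume.real (A ∩ quadrant) := measureReal_nonneg
  have hq0 : 0 ≤ volume.real (dualSet A ∩ quadrant) := measureReal_nonneg
  rw [hA.volume_mul_volume_dualSet, hmir]
  nlinarith

end Square

section Coordinates

/-- The determinant of two complex numbers, viewed as vectors in the plane. -/
def det (u v : ℂ) : ℝ := u.re * v.im - u.im * v.re

theorem det_ne_zero_iff_linearIndependent {u v : ℂ} :
    LinearIndependent ℝ ![u, v] ↔ det u v ≠ 0 := by
  rw [LinearIndependent.pair_iff]
  constructor
  · intro h h0
    unfold det at h0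
    have h1 := h v.im (-u.im) (by apply Complex.ext <;> simp <;> linarith)
    have h2 := h v.re (-u.re) (by apply Complex.ext <;> simp <;> linarith)
    have h3 := h 1 0 (by
      apply Complex.ext
      · simpa using h2.2
      · simpa using h1.2)
    exact one_ne_zero h3.1
  · intro h s t hst
    have hre := congrArg Complex.re hst
    have him := congrArg Complex.im hst
    simp at hre him
    refine ⟨(mul_eq_zero.1 (?_ : s * det u v = 0)).resolve_right h,
      (mul_eq_zero.1 (?_ : t * det u v = 0)).resolve_right h⟩
    · unfold det; linear_combination v.im * hre - v.re * him
    · unfold det; linear_combination u.re * him - u.im * hre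

theorem smul_add_smul_of_det {u v : ℂ} (h : det u v ≠ 0) (z : ℂ) :
    (det z v / det u v) • u + (det u z / det u v) • v = z := by
  apply Complex.ext
  · simp
    field_simp
    unfold det; ring
  · simp
    field_simp
    unfold det; ring

theorem smul_add_smul_inj {u v : ℂ} (h : det u v ≠ 0) {s t s' t' : ℝ}
    (heq : s • u + t • v = s' • u + t' • v) : s = s' ∧ t = t' := by
  have := (LinearIndependent.pair_iff.1 (det_ne_zero_iff_linearIndependent.2 h)) (s - s') (t - t')
    (by
      have e : (s - s') • u + (t - t') • v = (s • u + t • v) - (s' • u + t' • v) := by module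
      rw [e, heq, sub_self])
  exact ⟨sub_eq_zero.1 this.1, sub_eq_zero.1 this.2⟩

/-- The set `K` in coordinates with respect to `u` and `v`. -/
def coords (u v : ℂ) (K : Set ℂ) : Set (ℝ × ℝ) := {x | x.1 • u + x.2 • v ∈ K}

theorem volume_coords {u v : ℂ} (h : det u v ≠ 0) (K : Set ℂ) :
    volume.real (coords u v K) = |det u v|⁻¹ * area K := by
  have h1 := volume_preimage_linear (a := u.re) (b := v.re) (c := u.im) (d := v.im)
    (by unfold det at h; intro h0; apply h; linarith) (Complex.measurableEquivRealProd.symm ⁻¹' K)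
  have h2 : volume.real (Complex.measurableEquivRealProd.symm ⁻¹' K) = area K := by
    rw [measureReal_def, (Complex.volume_preserving_equiv_real_prod.symm
      Complex.measurableEquivRealProd).measure_preimage_equiv, area]
  rw [h2] at h1
  have e : u.re * v.im - v.re * u.im = det u v := by unfold det; ring
  rw [e] at h1
  rw [← h1]
  congr 1
  ext x
  have : x.1 • u + x.2 • v = Complex.measurableEquivRealProd.symm
      (u.re * x.1 + v.re * x.2, u.im * x.1 + v.im * x.2) := by
    apply Complex.ext <;> simp [Complex.measurableEquivRealProd] <;> ring
  change x.1 • u + x.2 • v ∈ K ↔ _ ∈ K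
  rw [this]

theorem dualSet_coords {u v : ℂ} (h : det u v ≠ 0) (K : Set ℂ) :
    dualSet (coords u v K) = coords ⟨v.im / det u v, -v.re / det u v⟩
      ⟨-u.im / det u v, u.re / det u v⟩ (polarBody K) := by
  have key (x y : ℝ × ℝ) : ⟪y.1 • (⟨v.im / det u v, -v.re / det u v⟩ : ℂ) +
      y.2 • (⟨-u.im / det u v, u.re / det u v⟩ : ℂ), x.1 • u + x.2 • v⟫ =
        x.1 * y.1 + x.2 * y.2 := by
    rw [Complex.inner]
    simp
    field_simp
    unfold det; ring
  ext y
  constructor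
  · intro hy z hz
    rw [← smul_add_smul_of_det h z] at hz ⊢
    rw [key (det z v / det u v, det u z / det u v) y]
    exact hy (det z v / det u v, det u z / det u v) hz
  · intro hy x hx
    rw [← key]
    exact hy _ hx

theorem area_mul_area_polarBody {u v : ℂ} (h : det u v ≠ 0) (K : Set ℂ) :
    area K * area (polarBody K) =
      volume.real (coords u v K) * volume.real (dualSet (coords u v K)) := by
  have hd : det ⟨v.im / det u v, -v.re / det u v⟩ ⟨-u.im / det u v, u.re / det u v⟩ =
      (det u v)⁻¹ := by
    have key (D : ℝ) : det ⟨v.im / D, -v.re / D⟩ ⟨-u.im / D, u.re / D⟩ = det u v / (D * D) := by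
      simp only [det]
      ring
    rw [key]
    field_simp
  rw [dualSet_coords h, volume_coords h, volume_coords (by rw [hd]; exact inv_ne_zero h), hd,
    abs_inv, inv_inv]
  have := abs_ne_zero.2 h
  field_simp

theorem convexHull_parallelogram (c u v : ℂ) :
    convexHull ℝ {c + u + v, c + u - v, c - u + v, c - u - v} =
      {z | ∃ s t : ℝ, |s| ≤ 1 ∧ |t| ≤ 1 ∧ z = c + s • u + t • v} := by
  apply Set.Subset.antisymm
  · apply convexHull_min
    · rintro z (rfl | rfl | rfl | rfl)
      · exact ⟨1, 1, by simp, by simp, by simp⟩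
      · exact ⟨1, -1, by simp, by simp, by simp; ring⟩
      · exact ⟨-1, 1, by simp, by simp, by simp; ring⟩
      · exact ⟨-1, -1, by simp, by simp, by simp; ring⟩
    · rintro _ ⟨s, t, hs, ht, rfl⟩ _ ⟨s', t', hs', ht', rfl⟩ a b ha hb hab
      refine ⟨a * s + b * s', a * t + b * t', ?_, ?_, ?_⟩
      · rw [abs_le] at *; constructor <;> nlinarith
      · rw [abs_le] at *; constructor <;> nlinarith
      · have : c = (a + b) • c := by rw [hab, one_smul]
        conv_rhs => rw [this]
        module
  · rintro _ ⟨s, t, hs, ht, rfl⟩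
    rw [abs_le] at hs ht
    set S : Set ℂ := {c + u + v, c + u - v, c - u + v, c - u - v} with hS
    have hC := convex_convexHull ℝ S
    have m1 : c + u + v ∈ convexHull ℝ S := subset_convexHull ℝ S (by simp [hS])
    have m2 : c + u - v ∈ convexHull ℝ S := subset_convexHull ℝ S (by simp [hS])
    have m3 : c - u + v ∈ convexHull ℝ S := subset_convexHull ℝ S (by simp [hS])
    have m4 : c - u - v ∈ convexHull ℝ S := subset_convexHull ℝ S (by simp [hS])
    have r := hC m1 m2 (a := (1 + t) / 2) (b := (1 - t) / 2) (by linarith) (by linarith) (by ring)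
    have l := hC m3 m4 (a := (1 + t) / 2) (b := (1 - t) / 2) (by linarith) (by linarith) (by ring)
    have := hC r l (a := (1 + s) / 2) (b := (1 - s) / 2) (by linarith) (by linarith) (by ring)
    convert this using 1
    module

theorem isParallelogram_of_coords_eq_square {u v : ℂ} (h : det u v ≠ 0) {K : Set ℂ}
    (hK : coords u v K = {x | |x.1| ≤ 1 ∧ |x.2| ≤ 1}) : IsParallelogram K := by
  refine ⟨0, u, v, det_ne_zero_iff_linearIndependent.2 h, ?_⟩
  rw [convexHull_parallelogram]
  ext z
  constructor
  · intro hz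
    have hz' : (det z v / det u v, det u z / det u v) ∈ coords u v K := by
      change _ • u + _ • v ∈ K
      rwa [smul_add_smul_of_det h]
    rw [hK] at hz'
    exact ⟨_, _, hz'.1, hz'.2, by rw [zero_add, smul_add_smul_of_det h]⟩
  · rintro ⟨s, t, hs, ht, rfl⟩
    have : (s, t) ∈ coords u v K := by rw [hK]; exact ⟨hs, ht⟩
    rw [zero_add]
    exact this

theorem coords_eq_square_of_isParallelogram {K : Set ℂ} (hsym : K = -K)
    (hK : IsParallelogram K) :
    ∃ u v : ℂ, det u v ≠ 0 ∧ coords u v K = {x | |x.1| ≤ 1 ∧ |x.2| ≤ 1} := by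
  obtain ⟨c, u, v, huv, hKeq⟩ := hK
  have h := det_ne_zero_iff_linearIndependent.1 huv
  rw [convexHull_parallelogram] at hKeq
  have hneg : ∀ s t : ℝ, |s| ≤ 1 → |t| ≤ 1 → ∃ s' t' : ℝ, |s'| ≤ 1 ∧ |t'| ≤ 1 ∧
      -(c + s • u + t • v) = c + s' • u + t' • v := by
    intro s t hs ht
    have : c + s • u + t • v ∈ K := by rw [hKeq]; exact ⟨s, t, hs, ht, rfl⟩
    rw [hsym, Set.mem_neg, hKeq] at this
    exact this
  obtain ⟨α, β, hc⟩ : ∃ α β : ℝ, c = α • u + β • v := ⟨_, _, (smul_add_smul_of_det h c).symm⟩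
  have aux : ∀ s t : ℝ, |s| ≤ 1 → |t| ≤ 1 → |-(2 * α) - s| ≤ 1 ∧ |-(2 * β) - t| ≤ 1 := by
    intro s t hs ht
    obtain ⟨s', t', hs', ht', heq⟩ := hneg s t hs ht
    rw [hc] at heq
    have := smul_add_smul_inj h (s := -(2 * α) - s) (t := -(2 * β) - t) (s' := s') (t' := t')
      (by
        have e : (-(2 * α) - s) • u + (-(2 * β) - t) • v =
          -(α • u + β • v + s • u + t • v) - (α • u + β • v) := by module
        rw [e, heq]
        module)
    rw [this.1, this.2]
    exact ⟨hs', ht'⟩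
  have a1 := aux 1 1 (by simp) (by simp)
  have a2 := aux (-1) (-1) (by simp) (by simp)
  simp only [abs_le] at a1 a2
  have hα : α = 0 := by linarith
  have hβ : β = 0 := by linarith
  have hc0 : c = 0 := by rw [hc, hα, hβ]; simp
  refine ⟨u, v, h, ?_⟩
  ext x
  change x.1 • u + x.2 • v ∈ K ↔ |x.1| ≤ 1 ∧ |x.2| ≤ 1
  rw [hKeq, hc0]
  constructor
  · rintro ⟨s, t, hs, ht, heq⟩
    rw [zero_add] at heq
    obtain ⟨h1, h2⟩ := smul_add_smul_inj h heq
    rw [h1, h2]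
    exact ⟨hs, ht⟩
  · rintro ⟨hs, ht⟩
    exact ⟨x.1, x.2, hs, ht, by rw [zero_add]⟩

/-- Every centrally symmetric convex body has an Auerbach basis. -/
theorem exists_isAuerbach_coords {K : Set ℂ} (hK : IsConvexBody K) (hsym : K = -K)
    (ho : (0 : ℂ) ∈ interior K) : ∃ u v : ℂ, det u v ≠ 0 ∧ IsAuerbach (coords u v K) := by
  obtain ⟨hconv, hcomp, -⟩ := hK
  have hneg : ∀ z ∈ K, -z ∈ K := fun z hz ↦ by rwa [hsym, Set.neg_mem_neg]
  have hcont : Continuous fun p : ℂ × ℂ ↦ det p.1 p.2 := by unfold det; fun_prop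
  have h0 : (0 : ℂ) ∈ K := interior_subset ho
  obtain ⟨⟨u, v⟩, ⟨hu, hv⟩, hmax⟩ :=
    (hcomp.prod hcomp).exists_isMaxOn ⟨(0, 0), h0, h0⟩ hcont.continuousOn
  have hle : ∀ x ∈ K, ∀ y ∈ K, det x y ≤ det u v := fun x hx y hy ↦
    hmax (show (x, y) ∈ K ×ˢ K from ⟨hx, hy⟩)
  have hd : 0 < det u v := by
    obtain ⟨r, hr, hball⟩ := Metric.mem_nhds_iff.1 (mem_interior_iff_mem_nhds.1 ho)
    have m1 : ((r / 2 : ℝ) : ℂ) ∈ K := hball (by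
      rw [mem_ball_zero_iff, Complex.norm_real, Real.norm_of_nonneg (by positivity)]
      linarith)
    have m2 : ((r / 2 : ℝ) : ℂ) * Complex.I ∈ K := hball (by
      rw [mem_ball_zero_iff, norm_mul, Complex.norm_I, mul_one, Complex.norm_real,
        Real.norm_of_nonneg (by positivity)]
      linarith)
    refine lt_of_lt_of_le ?_ (hle _ m1 _ m2)
    simp only [det, Complex.ofReal_re, Complex.ofReal_im, Complex.mul_im, Complex.mul_re,
      Complex.I_re, Complex.I_im]
    nlinarith
  refine ⟨u, v, hd.ne', ?_⟩
  constructor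
  · intro x hx y hy a b ha hb hab
    have := hconv hx hy ha hb hab
    change _ • u + _ • v ∈ K
    convert this using 1
    simp only [Prod.fst_add, Prod.snd_add, Prod.smul_fst, Prod.smul_snd, smul_eq_mul]
    module
  · exact hcomp.isClosed.preimage (by fun_prop : Continuous fun x : ℝ × ℝ ↦ x.1 • u + x.2 • v)
  · intro x hx
    have := hneg _ hx
    change (-x.1) • u + (-x.2) • v ∈ K
    convert this using 1
    module
  · change (1 : ℝ) • u + (0 : ℝ) • v ∈ K
    simpa using hu
  · change (0 : ℝ) • u + (1 : ℝ) • v ∈ K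
    simpa using hv
  · intro x hx
    have h1 := hle _ hx v hv
    have h2 := hle u hu _ hx
    have e1 : det (x.1 • u + x.2 • v) v = x.1 * det u v := by simp [det]; ring
    have e2 : det u (x.1 • u + x.2 • v) = x.2 * det u v := by simp [det]; ring
    rw [e1] at h1
    rw [e2] at h2
    constructor <;> nlinarith

end Coordinates

end PlanarMahler

/-- Mahler–Reisner: for an `o`-symmetric planar convex body, `|K|·|K*| ≥ 8`,
with equality iff `K` is a parallelogram. -/
theorem mahler_reisner (K : Set ℂ) (hK : IsConvexBody K) (hsym : K = -K)
    (ho : (0 : ℂ) ∈ interior K) :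
    8 ≤ area K * area (polarBody K) ∧
      (area K * area (polarBody K) = 8 ↔ IsParallelogram K) := by
  open PlanarMahler in
  obtain ⟨u, v, hd, hA⟩ := exists_isAuerbach_coords hK hsym ho
  have h8 := hA.eight_le
  rw [← area_mul_area_polarBody hd] at h8
  refine ⟨h8, fun heq ↦ ?_, fun hpar ↦ le_antisymm ?_ h8⟩
  · rw [area_mul_area_polarBody hd] at heq
    rcases hA.eq_square_or_eq_cross_polytope heq with h | h
    · exact isParallelogram_of_coords_eq_square hd h
    · have hd' : det ((1 / 2 : ℝ) • (u + v)) ((1 / 2 : ℝ) • (u - v)) ≠ 0 := by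
        have : det ((1 / 2 : ℝ) • (u + v)) ((1 / 2 : ℝ) • (u - v)) = -(det u v) / 2 := by
          simp [det]; ring
        rw [this]
        exact div_ne_zero (neg_ne_zero.2 hd) two_ne_zero
      refine isParallelogram_of_coords_eq_square hd' ?_
      ext x
      have e : x.1 • (1 / 2 : ℝ) • (u + v) + x.2 • (1 / 2 : ℝ) • (u - v) =
        ((x.1 + x.2) / 2) • u + ((x.1 - x.2) / 2) • v := by module
      change x.1 • (1 / 2 : ℝ) • (u + v) + x.2 • (1 / 2 : ℝ) • (u - v) ∈ K ↔
        |x.1| ≤ 1 ∧ |x.2| ≤ 1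
      rw [e]
      change ((x.1 + x.2) / 2, (x.1 - x.2) / 2) ∈ coords u v K ↔ _
      rw [h]
      change |(x.1 + x.2) / 2| + |(x.1 - x.2) / 2| ≤ 1 ↔ _
      constructor
      · intro hx
        have := abs_le.1 ((abs_add_le _ _).trans hx)
        have := abs_le.1 ((abs_sub _ _).trans hx)
        constructor <;> rw [abs_le] <;> constructor <;> linarith
      · rintro ⟨h1, h2⟩
        rw [abs_le] at h1 h2
        rcases abs_cases ((x.1 + x.2) / 2) with c | c <;>
          rcases abs_cases ((x.1 - x.2) / 2) with c' | c' <;> linarith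
  · obtain ⟨u', v', hd', hsq⟩ := coords_eq_square_of_isParallelogram hsym hpar
    rw [area_mul_area_polarBody hd', hsq]
    exact volume_square_mul_volume_dualSet_le
end

section
/- Let K be a convex body in ℝ² with o in the interior of K. Then |K|·|K*| ≥ 27/4, and equality holds if and only if K is a triangle whose centroid is o. -/
open MeasureTheory Pointwise Real
open scoped RealInnerProductSpace

/-- `K` is a triangle with centroid at the origin. -/
def IsTriangleCentroidZero (K : Set ℂ) : Prop :=
  ∃ a b c : ℂ, AffineIndependent ℝ ![a, b, c] ∧ K = convexHull ℝ {a, b, c} ∧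
    (a + b + c) / 3 = 0

/-- The determinant of the pair of plane vectors `u`, `v`. -/
noncomputable def crossProd (u v : ℂ) : ℝ := u.re * v.im - u.im * v.re

/-- Twice the signed area of the triangle with vertices `a`, `b`, `c`. -/
noncomputable def signedArea (a b c : ℂ) : ℝ := crossProd (b - a) (c - a)

lemma inner_eq_re_im (x y : ℂ) : ⟪x, y⟫ = x.re * y.re + x.im * y.im := by
  rw [Complex.inner]
  simp only [Complex.mul_re, Complex.conj_re, Complex.conj_im]
  ring

lemma mem_convexHull_triple_iff (a b c p : ℂ) :
    p ∈ convexHull ℝ ({a, b, c} : Set ℂ) ↔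
      ∃ r s t : ℝ, 0 ≤ r ∧ 0 ≤ s ∧ 0 ≤ t ∧ r + s + t = 1 ∧
        r * a.re + s * b.re + t * c.re = p.re ∧ r * a.im + s * b.im + t * c.im = p.im := by
  constructor
  · intro h
    refine convexHull_min (t := {p : ℂ | ∃ r s t : ℝ, 0 ≤ r ∧ 0 ≤ s ∧ 0 ≤ t ∧ r + s + t = 1 ∧
        r * a.re + s * b.re + t * c.re = p.re ∧ r * a.im + s * b.im + t * c.im = p.im}) ?_ ?_ h
    · rintro x (rfl | rfl | rfl)
      · exact ⟨1, 0, 0, by norm_num, by norm_num, by norm_num, by norm_num, by ring, by ring⟩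
      · exact ⟨0, 1, 0, by norm_num, by norm_num, by norm_num, by norm_num, by ring, by ring⟩
      · exact ⟨0, 0, 1, by norm_num, by norm_num, by norm_num, by norm_num, by ring, by ring⟩
    · rintro x ⟨r, s, t, hr, hs, ht, h1, hx, hx'⟩ y ⟨r', s', t', hr', hs', ht', h1', hy, hy'⟩
        u v hu hv huv
      refine ⟨u * r + v * r', u * s + v * s', u * t + v * t', by positivity, by positivity,
        by positivity, ?_, ?_, ?_⟩
      · linear_combination u * h1 + v * h1' + huv
      · simp only [Complex.add_re, Complex.real_smul, Complex.mul_re, Complex.ofReal_re,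
          Complex.ofReal_im]
        linear_combination u * hx + v * hy
      · simp only [Complex.add_im, Complex.real_smul, Complex.mul_im, Complex.ofReal_re,
          Complex.ofReal_im]
        linear_combination u * hx' + v * hy'
  · rintro ⟨r, s, t, hr, hs, ht, h1, hx, hx'⟩
    have key : p = r • a + s • b + t • c := by
      apply Complex.ext
      · simp only [Complex.add_re, Complex.real_smul, Complex.mul_re, Complex.ofReal_re,
          Complex.ofReal_im]
        linarith
      · simp only [Complex.add_im, Complex.real_smul, Complex.mul_im, Complex.ofReal_re,
          Complex.ofReal_im]
        linarith
    rw [key]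
    have := (convex_convexHull ℝ ({a, b, c} : Set ℂ)).sum_mem (t := Finset.univ)
      (w := ![r, s, t]) (z := ![a, b, c]) (by intro i _; fin_cases i <;> simpa)
      (by simp [Fin.sum_univ_three, h1])
      (by intro i _; apply subset_convexHull; fin_cases i <;> simp)
    simpa [Fin.sum_univ_three] using this

lemma isCompact_triangle (a b c : ℂ) : IsCompact (convexHull ℝ ({a, b, c} : Set ℂ)) :=
  (Set.toFinite _).isCompact_convexHull ℝ

lemma volume_convexHull_zero_one_I :
    volume (convexHull ℝ ({0, 1, Complex.I} : Set ℂ)) = ENNReal.ofReal (1 / 2) := by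
  have hS : convexHull ℝ ({0, 1, Complex.I} : Set ℂ) =
      Complex.measurableEquivRealProd ⁻¹' {q : ℝ × ℝ | 0 ≤ q.1 ∧ 0 ≤ q.2 ∧ q.1 + q.2 ≤ 1} := by
    ext p
    rw [mem_convexHull_triple_iff]
    simp only [Complex.zero_re, Complex.one_re, Complex.I_re, Complex.zero_im, Complex.one_im,
      Complex.I_im, Set.mem_preimage, Set.mem_ofPred_eq, Complex.measurableEquivRealProd_apply]
    constructor
    · rintro ⟨r, s, t, hr, hs, ht, h1, hx, hx'⟩
      exact ⟨by linarith, by linarith, by linarith⟩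
    · rintro ⟨h1, h2, h3⟩
      exact ⟨1 - p.re - p.im, p.re, p.im, by linarith, h1, h2, by ring, by ring, by ring⟩
  have hmeas : MeasurableSet {q : ℝ × ℝ | 0 ≤ q.1 ∧ 0 ≤ q.2 ∧ q.1 + q.2 ≤ 1} := by
    refine IsClosed.measurableSet ?_
    exact (isClosed_le continuous_const continuous_fst).inter
      ((isClosed_le continuous_const continuous_snd).inter
        (isClosed_le (continuous_fst.add continuous_snd) continuous_const))
  rw [hS, Complex.volume_preserving_equiv_real_prod.measure_preimage hmeas.nullMeasurableSet,
    Measure.volume_eq_prod, Measure.prod_apply hmeas]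
  have hslice : ∀ x : ℝ, volume (Prod.mk x ⁻¹' {q : ℝ × ℝ | 0 ≤ q.1 ∧ 0 ≤ q.2 ∧ q.1 + q.2 ≤ 1}) =
      (Set.Icc (0 : ℝ) 1).indicator (fun x => ENNReal.ofReal (1 - x)) x := by
    intro x
    by_cases hx : x ∈ Set.Icc (0 : ℝ) 1
    · rw [Set.indicator_of_mem hx]
      have : Prod.mk x ⁻¹' {q : ℝ × ℝ | 0 ≤ q.1 ∧ 0 ≤ q.2 ∧ q.1 + q.2 ≤ 1} =
          Set.Icc 0 (1 - x) := by
        ext y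
        simp only [Set.mem_preimage, Set.mem_ofPred_eq, Set.mem_Icc]
        exact ⟨fun h => ⟨h.2.1, by linarith⟩, fun h => ⟨hx.1, h.1, by linarith⟩⟩
      rw [this, Real.volume_Icc, sub_zero]
    · rw [Set.indicator_of_notMem hx]
      have : Prod.mk x ⁻¹' {q : ℝ × ℝ | 0 ≤ q.1 ∧ 0 ≤ q.2 ∧ q.1 + q.2 ≤ 1} = ∅ := by
        ext y
        simp only [Set.mem_preimage, Set.mem_ofPred_eq, Set.mem_empty_iff_false, iff_false]
        exact fun h => hx ⟨h.1, by linarith⟩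
      rw [this, measure_empty]
  simp_rw [hslice]
  rw [lintegral_indicator measurableSet_Icc, ← ofReal_integral_eq_lintegral_ofReal]
  · congr 1
    rw [integral_Icc_eq_integral_Ioc, ← intervalIntegral.integral_of_le zero_le_one]
    rw [intervalIntegral.integral_sub (by simp) (by simp)]
    norm_num
  · exact (continuous_const.sub continuous_id).continuousOn.integrableOn_compact isCompact_Icc
  · filter_upwards [ae_restrict_mem measurableSet_Icc] with x hx
    exact sub_nonneg.2 hx.2

lemma volume_triangle (a b c : ℂ) :
    volume (convexHull ℝ ({a, b, c} : Set ℂ)) = ENNReal.ofReal (|signedArea a b c| / 2) := by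
  set f : ℂ →ₗ[ℝ] ℂ := Matrix.toLin Complex.basisOneI Complex.basisOneI
    !![(b - a).re, (c - a).re; (b - a).im, (c - a).im] with hf
  have hdet : LinearMap.det f = signedArea a b c := by
    rw [hf, LinearMap.det_toLin, Matrix.det_fin_two_of, signedArea, crossProd]
    ring
  have hf1 : f 1 = b - a := by
    have : (1 : ℂ) = Complex.basisOneI 0 := by simp
    rw [this, hf, Matrix.toLin_self]
    simp only [Fin.sum_univ_two]
    apply Complex.ext <;> simp
  have hfI : f Complex.I = c - a := by
    have : Complex.I = Complex.basisOneI 1 := by simp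
    rw [this, hf, Matrix.toLin_self]
    simp only [Fin.sum_univ_two]
    apply Complex.ext <;> simp
  have himg : convexHull ℝ ({a, b, c} : Set ℂ) =
      (fun z => a + z) '' (f '' convexHull ℝ ({0, 1, Complex.I} : Set ℂ)) := by
    rw [LinearMap.image_convexHull, Set.image_add_left]
    have : (fun z => -a + z) ⁻¹' (convexHull ℝ (f '' {0, 1, Complex.I})) =
        (a +ᵥ (convexHull ℝ (f '' {0, 1, Complex.I}))) := by
      rw [← Set.image_vadd]; simp [Set.image_add_left]
    rw [this, ← convexHull_vadd]
    congr 1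
    simp [Set.image_insert_eq, ← Set.image_vadd, hf1, hfI]
  rw [himg, Set.image_add_left, measure_preimage_add, Measure.addHaar_image_linearMap,
    volume_convexHull_zero_one_I, hdet, ← ENNReal.ofReal_mul (abs_nonneg _)]
  congr 1
  ring

lemma area_triangle (a b c : ℂ) :
    area (convexHull ℝ {a, b, c}) = |signedArea a b c| / 2 := by
  rw [area, volume_triangle, ENNReal.toReal_ofReal (by positivity)]

lemma mem_triangle_iff {a b c : ℂ} (h : 0 < signedArea a b c) (p : ℂ) :
    p ∈ convexHull ℝ ({a, b, c} : Set ℂ) ↔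
      0 ≤ signedArea a b p ∧ 0 ≤ signedArea b c p ∧ 0 ≤ signedArea c a p := by
  rw [mem_convexHull_triple_iff]
  constructor
  · rintro ⟨r, s, t, hr, hs, ht, h1, hx, hx'⟩
    obtain rfl : r = 1 - s - t := by linarith
    have e1 : signedArea a b p = t * signedArea a b c := by
      simp only [signedArea, crossProd, Complex.sub_re, Complex.sub_im, ← hx, ← hx']; ring
    have e2 : signedArea b c p = (1 - s - t) * signedArea a b c := by
      simp only [signedArea, crossProd, Complex.sub_re, Complex.sub_im, ← hx, ← hx']; ring
    have e3 : signedArea c a p = s * signedArea a b c := by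
      simp only [signedArea, crossProd, Complex.sub_re, Complex.sub_im, ← hx, ← hx']; ring
    rw [e1, e2, e3]
    exact ⟨by positivity, by positivity, by positivity⟩
  · rintro ⟨h1, h2, h3⟩
    refine ⟨signedArea b c p / signedArea a b c, signedArea c a p / signedArea a b c,
      signedArea a b p / signedArea a b c, by positivity, by positivity, by positivity, ?_, ?_, ?_⟩
    all_goals
      field_simp
      simp only [signedArea, crossProd, Complex.sub_re, Complex.sub_im]
      ring

lemma signedArea_rotate (a b c : ℂ) : signedArea b c a = signedArea a b c := by
  simp only [signedArea, crossProd, Complex.sub_re, Complex.sub_im]; ring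

lemma signedArea_swap (a b c : ℂ) : signedArea b a c = -signedArea a b c := by
  simp only [signedArea, crossProd, Complex.sub_re, Complex.sub_im]; ring

lemma signedArea_self_left (a b : ℂ) : signedArea a b a = 0 := by
  simp only [signedArea, crossProd, Complex.sub_re, Complex.sub_im]; ring

lemma signedArea_self_right (a b : ℂ) : signedArea a b b = 0 := by
  simp only [signedArea, crossProd, Complex.sub_re, Complex.sub_im]; ring

lemma signedArea_add_add (a b c p : ℂ) :
    signedArea a b p + signedArea b c p + signedArea c a p = signedArea a b c := by
  simp only [signedArea, crossProd, Complex.sub_re, Complex.sub_im]; ring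

lemma signedArea_combination (a b : ℂ) {x y : ℂ} {s t : ℝ} (h : s + t = 1) :
    signedArea a b (s • x + t • y) = s * signedArea a b x + t * signedArea a b y := by
  obtain rfl : s = 1 - t := by linarith
  simp only [signedArea, crossProd, Complex.sub_re, Complex.sub_im, Complex.add_re, Complex.add_im,
    Complex.real_smul, Complex.mul_re, Complex.mul_im, Complex.ofReal_re, Complex.ofReal_im]
  ring

lemma convex_nonneg_signedArea (a b : ℂ) : Convex ℝ {p | 0 ≤ signedArea a b p} := by
  intro x hx y hy s t hs ht hst
  simp only [Set.mem_ofPred_eq] at hx hy ⊢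
  rw [signedArea_combination a b hst]
  positivity

lemma convex_nonpos_signedArea (a b : ℂ) : Convex ℝ {p | signedArea a b p ≤ 0} := by
  intro x hx y hy s t hs ht hst
  simp only [Set.mem_ofPred_eq] at hx hy ⊢
  rw [signedArea_combination a b hst]
  nlinarith

lemma volume_signedArea_eq_zero {a b c : ℂ} (h : signedArea a b c ≠ 0) :
    volume {p | signedArea a b p = 0} = 0 := by
  have hsub : {p | signedArea a b p = 0} ⊆ frontier {p | 0 ≤ signedArea a b p} := by
    intro p hp
    simp only [Set.mem_ofPred_eq] at hp
    have hcont : Continuous fun t : ℝ => p - t • (signedArea a b c • (c - a)) := by fun_prop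
    have hval : ∀ t : ℝ, signedArea a b (p - t • (signedArea a b c • (c - a))) =
        -t * signedArea a b c ^ 2 := by
      intro t
      have : signedArea a b (p - t • (signedArea a b c • (c - a))) =
          signedArea a b p - t * signedArea a b c ^ 2 := by
        simp only [signedArea, crossProd, Complex.sub_re, Complex.sub_im,
          Complex.real_smul, Complex.mul_re, Complex.mul_im, Complex.ofReal_re, Complex.ofReal_im]
        ring
      rw [this, hp]; ring
    refine ⟨subset_closure (le_of_eq hp.symm), fun hin => ?_⟩
    have hnhds : ∀ᶠ t : ℝ in nhds 0, p - t • (signedArea a b c • (c - a)) ∈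
        {p | 0 ≤ signedArea a b p} := by
      refine hcont.continuousAt.eventually_mem ?_
      rw [zero_smul, sub_zero]
      exact mem_interior_iff_mem_nhds.1 hin
    obtain ⟨ε, hε, hball⟩ := Metric.eventually_nhds_iff.1 hnhds
    have h1 := hball (y := ε / 2) (by
      rw [Real.dist_eq, sub_zero, abs_of_pos (by linarith)]; linarith)
    simp only [Set.mem_ofPred_eq, hval] at h1
    have := sq_pos_of_ne_zero h
    nlinarith
  exact measure_mono_null hsub ((convex_nonneg_signedArea a b).addHaar_frontier _)

lemma area_mono {s t : Set ℂ} (ht : IsCompact t) (h : s ⊆ t) : area s ≤ area t :=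
  ENNReal.toReal_mono ht.measure_lt_top.ne (measure_mono h)

/-- A closed subset of full area of a convex body is the whole body. -/
lemma eq_of_subset_of_area_le {K F : Set ℂ} (hK : IsConvexBody K) (hF : IsClosed F) (hFK : F ⊆ K)
    (h : area K ≤ area F) : F = K := by
  obtain ⟨hconv, hcomp, hin⟩ := hK
  refine hFK.antisymm ?_
  have hnull : volume (interior K \ F) = 0 := by
    have hle : volume K ≤ volume F :=
      (ENNReal.toReal_le_toReal hcomp.measure_lt_top.ne
        (measure_mono hFK |>.trans_lt hcomp.measure_lt_top).ne).1 h
    have h0 : volume (K \ F) = 0 := by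
      rw [measure_sdiff hFK hF.measurableSet.nullMeasurableSet
        (measure_mono hFK |>.trans_lt hcomp.measure_lt_top).ne]
      exact tsub_eq_zero_of_le hle
    exact measure_mono_null (Set.sdiff_subset_sdiff_left interior_subset) h0
  have hempty : interior K \ F = ∅ :=
    (isOpen_interior.sdiff hF).eq_empty_of_measure_zero hnull
  have h1 : interior K ⊆ F := Set.sdiff_eq_empty.1 hempty
  have h2 := closure_minimal h1 hF
  rw [hconv.closure_interior_eq_closure_of_nonempty_interior hin] at h2
  exact subset_closure.trans h2

/-- The triangle `a b c` together with three triangles erected outwards on its sides. -/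
def triangleStar (a b c x y z : ℂ) : Set ℂ :=
  convexHull ℝ {a, b, c} ∪ convexHull ℝ {a, b, x} ∪ convexHull ℝ {b, c, y} ∪
    convexHull ℝ {c, a, z}

lemma isCompact_triangleStar (a b c x y z : ℂ) : IsCompact (triangleStar a b c x y z) :=
  (((isCompact_triangle _ _ _).union (isCompact_triangle _ _ _)).union
    (isCompact_triangle _ _ _)).union (isCompact_triangle _ _ _)

lemma triangle_subset {K : Set ℂ} (hK : Convex ℝ K) {a b c : ℂ} (ha : a ∈ K) (hb : b ∈ K)
    (hc : c ∈ K) : convexHull ℝ {a, b, c} ⊆ K :=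
  convexHull_min (by rintro p (rfl | rfl | rfl) <;> assumption) hK

lemma triangleStar_subset {K : Set ℂ} (hK : Convex ℝ K) {a b c x y z : ℂ} (ha : a ∈ K)
    (hb : b ∈ K) (hc : c ∈ K) (hx : x ∈ K) (hy : y ∈ K) (hz : z ∈ K) :
    triangleStar a b c x y z ⊆ K :=
  Set.union_subset (Set.union_subset (Set.union_subset (triangle_subset hK ha hb hc)
    (triangle_subset hK ha hb hx)) (triangle_subset hK hb hc hy)) (triangle_subset hK hc ha hz)

lemma triangle_subset_of_signedArea {a b c x : ℂ} (h : 0 < signedArea a b c)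
    (h1 : signedArea a b x ≤ 0) (h2 : 0 ≤ signedArea b c x) (h3 : 0 ≤ signedArea c a x) :
    convexHull ℝ {a, b, x} ⊆
      {p | signedArea a b p ≤ 0 ∧ 0 ≤ signedArea b c p ∧ 0 ≤ signedArea c a p} := by
  have ha : 0 ≤ signedArea b c a := (signedArea_rotate a b c).symm ▸ h.le
  have hb : 0 ≤ signedArea c a b := by
    rw [signedArea_rotate, signedArea_rotate]; exact h.le
  refine triangle_subset ((convex_nonpos_signedArea a b).inter
    ((convex_nonneg_signedArea b c).inter (convex_nonneg_signedArea c a))) ?_ ?_ ⟨h1, h2, h3⟩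
  · exact ⟨(signedArea_self_left a b).le, ha, (signedArea_self_right c a).ge⟩
  · exact ⟨(signedArea_self_right a b).le, (signedArea_self_left b c).ge, hb⟩

lemma area_triangleStar {a b c x y z : ℂ} (h : 0 < signedArea a b c)
    (hx1 : signedArea a b x ≤ 0) (hx2 : 0 ≤ signedArea b c x) (hx3 : 0 ≤ signedArea c a x)
    (hy1 : 0 ≤ signedArea a b y) (hy2 : signedArea b c y ≤ 0) (hy3 : 0 ≤ signedArea c a y)
    (hz1 : 0 ≤ signedArea a b z) (hz2 : 0 ≤ signedArea b c z) (hz3 : signedArea c a z ≤ 0) :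
    area (triangleStar a b c x y z) =
      (signedArea a b c - signedArea a b x - signedArea b c y - signedArea c a z) / 2 := by
  have hbca : 0 < signedArea b c a := (signedArea_rotate a b c).symm ▸ h
  have hcab : 0 < signedArea c a b := (signedArea_rotate b c a).symm ▸ hbca
  have s0 : convexHull ℝ {a, b, c} ⊆
      {p | 0 ≤ signedArea a b p ∧ 0 ≤ signedArea b c p ∧ 0 ≤ signedArea c a p} :=
    fun p hp => (mem_triangle_iff h p).1 hp
  have s1 := triangle_subset_of_signedArea h hx1 hx2 hx3
  have s2 := triangle_subset_of_signedArea hbca hy2 hy3 hy1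
  have s3 := triangle_subset_of_signedArea hcab hz3 hz1 hz2
  have n1 := volume_signedArea_eq_zero h.ne'
  have n2 := volume_signedArea_eq_zero hbca.ne'
  have n3 := volume_signedArea_eq_zero hcab.ne'
  have m : ∀ a b c : ℂ, NullMeasurableSet (convexHull ℝ ({a, b, c} : Set ℂ)) volume :=
    fun a b c => (isCompact_triangle a b c).measurableSet.nullMeasurableSet
  have hunion : volume (triangleStar a b c x y z) = volume (convexHull ℝ ({a, b, c} : Set ℂ)) +
      volume (convexHull ℝ ({a, b, x} : Set ℂ)) + volume (convexHull ℝ ({b, c, y} : Set ℂ)) +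
      volume (convexHull ℝ ({c, a, z} : Set ℂ)) := by
    rw [triangleStar, measure_union₀ (m _ _ _), measure_union₀ (m _ _ _), measure_union₀ (m _ _ _)]
    · refine measure_mono_null ?_ n1
      rintro p ⟨hp, hp'⟩
      exact le_antisymm (s1 hp').1 (s0 hp).1
    · refine measure_mono_null ?_ n2
      rintro p ⟨hp | hp, hp'⟩
      · exact le_antisymm (s2 hp').1 (s0 hp).2.1
      · exact le_antisymm (s2 hp').1 (s1 hp).2.1
    · refine measure_mono_null ?_ n3
      rintro p ⟨(hp | hp) | hp, hp'⟩
      · exact le_antisymm (s3 hp').1 (s0 hp).2.2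
      · exact le_antisymm (s3 hp').1 (s1 hp).2.2
      · exact le_antisymm (s3 hp').1 (s2 hp).2.1
  rw [area, hunion, volume_triangle, volume_triangle, volume_triangle, volume_triangle,
    ← ENNReal.ofReal_add (by positivity) (by positivity),
    ← ENNReal.ofReal_add (by positivity) (by positivity),
    ← ENNReal.ofReal_add (by positivity) (by positivity), ENNReal.toReal_ofReal (by positivity),
    abs_of_pos h, abs_of_nonpos hx1, abs_of_nonpos hy2, abs_of_nonpos hz3]
  ring

lemma mul_le_add_pow_three {x y z : ℝ} (hx : 0 < x) (hy : 0 < y) (hz : 0 < z) :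
    27 * (x * y * z) ≤ (x + y + z) ^ 3 := by
  nlinarith [mul_nonneg hx.le (sq_nonneg (y - z)), mul_nonneg hy.le (sq_nonneg (x - z)),
    mul_nonneg hz.le (sq_nonneg (x - y)), mul_nonneg hx.le (sq_nonneg (x - y)),
    mul_nonneg hx.le (sq_nonneg (x - z)), mul_nonneg hy.le (sq_nonneg (y - z)),
    mul_nonneg hy.le (sq_nonneg (y - x)), mul_nonneg hz.le (sq_nonneg (z - y)),
    mul_nonneg hz.le (sq_nonneg (z - x))]

lemma eq_of_add_pow_three_le {x y z : ℝ} (hx : 0 < x) (hy : 0 < y) (hz : 0 < z)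
    (h : (x + y + z) ^ 3 ≤ 27 * (x * y * z)) : x = y ∧ y = z := by
  have key : (x + y + z) ^ 3 - 27 * (x * y * z) =
      (x + y + z) / 2 * ((x - y) ^ 2 + (y - z) ^ 2 + (z - x) ^ 2) +
      3 * (x * (y - z) ^ 2 + y * (z - x) ^ 2 + z * (x - y) ^ 2) := by ring
  have h1 : 0 ≤ (x + y + z) / 2 * (y - z) ^ 2 := by positivity
  have h2 : 0 ≤ (x + y + z) / 2 * (z - x) ^ 2 := by positivity
  have h3 : 0 ≤ x * (y - z) ^ 2 + y * (z - x) ^ 2 + z * (x - y) ^ 2 := by positivity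
  have h4 : 0 ≤ (x + y + z) / 2 * (x - y) ^ 2 := by positivity
  have hs : 0 < (x + y + z) / 2 := by positivity
  constructor
  · have : (x - y) ^ 2 ≤ 0 := by
      by_contra! hc
      nlinarith [mul_pos hs hc]
    nlinarith [pow_eq_zero_iff (two_ne_zero) |>.1 (le_antisymm this (sq_nonneg _))]
  · have : (y - z) ^ 2 ≤ 0 := by
      by_contra! hc
      nlinarith [mul_pos hs hc]
    nlinarith [pow_eq_zero_iff (two_ne_zero) |>.1 (le_antisymm this (sq_nonneg _))]

lemma le_sum_mul_sum_mul_sum {r s t u v w : ℝ} (hr : 0 < r) (hs : 0 < s) (ht : 0 < t)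
    (hu : 0 < u) (hv : 0 < v) (hw : 0 < w) :
    27 ≤ (r + s + t) * (u + v + w) * (1 / (r * u) + 1 / (s * v) + 1 / (t * w)) := by
  have h1 := mul_le_add_pow_three hr hs ht
  have h2 := mul_le_add_pow_three hu hv hw
  have h3 := mul_le_add_pow_three (x := 1 / (r * u)) (y := 1 / (s * v)) (z := 1 / (t * w))
    (by positivity) (by positivity) (by positivity)
  refine le_of_pow_le_pow_left₀ three_ne_zero (by positivity) ?_
  calc (27 : ℝ) ^ 3 = 27 * (r * s * t) * (27 * (u * v * w)) *
        (27 * (1 / (r * u) * (1 / (s * v)) * (1 / (t * w)))) := by field_simp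
    _ ≤ (r + s + t) ^ 3 * (u + v + w) ^ 3 * (1 / (r * u) + 1 / (s * v) + 1 / (t * w)) ^ 3 := by
        gcongr
    _ = _ := by ring

lemma le_of_mul_mul_le {a b c a' b' c' : ℝ} (ha : 0 < a) (hc : 0 < c) (hb' : 0 < b')
    (hc' : 0 < c') (hb : b ≤ b') (hcc : c ≤ c')
    (h : a' * b' * c' ≤ a * b * c) : a' ≤ a := by
  have h1 : a * b * c ≤ a * (b' * c') := by
    rw [mul_assoc]
    gcongr
  have h2 : a' * (b' * c') ≤ a * (b' * c') := by linarith
  exact le_of_mul_le_mul_right h2 (by positivity)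

lemma eq_of_sum_mul_sum_mul_sum_le {r s t u v w : ℝ} (hr : 0 < r) (hs : 0 < s) (ht : 0 < t)
    (hu : 0 < u) (hv : 0 < v) (hw : 0 < w)
    (h : (r + s + t) * (u + v + w) * (1 / (r * u) + 1 / (s * v) + 1 / (t * w)) ≤ 27) :
    (r = s ∧ s = t) ∧ u = v ∧ v = w := by
  have h1 := mul_le_add_pow_three hr hs ht
  have h2 := mul_le_add_pow_three hu hv hw
  have h3 := mul_le_add_pow_three (x := 1 / (r * u)) (y := 1 / (s * v)) (z := 1 / (t * w))
    (by positivity) (by positivity) (by positivity)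
  have hprod : 27 * (r * s * t) * (27 * (u * v * w)) *
        (27 * (1 / (r * u) * (1 / (s * v)) * (1 / (t * w)))) = 19683 := by
    field_simp
    norm_num
  have hpos : 0 ≤ (r + s + t) * (u + v + w) * (1 / (r * u) + 1 / (s * v) + 1 / (t * w)) := by
    positivity
  have hle : (r + s + t) ^ 3 * (u + v + w) ^ 3 *
      (1 / (r * u) + 1 / (s * v) + 1 / (t * w)) ^ 3 ≤ 19683 := by
    rw [← mul_pow, ← mul_pow]
    exact (pow_le_pow_left₀ hpos h 3).trans (by norm_num)
  have hp1 : 0 < 27 * (r * s * t) := by positivity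
  have hp2 : 0 < 27 * (u * v * w) := by positivity
  have hp3 : 0 < 27 * (1 / (r * u) * (1 / (s * v)) * (1 / (t * w))) := by positivity
  refine ⟨eq_of_add_pow_three_le hr hs ht ?_, eq_of_add_pow_three_le hu hv hw ?_⟩
  · exact le_of_mul_mul_le hp1 hp3 (hp2.trans_le h2) (hp3.trans_le h3) h2 h3 (hle.trans hprod.ge)
  · refine le_of_mul_mul_le hp2 hp3 (hp1.trans_le h1) (hp3.trans_le h3) h1 h3 ?_
    linarith [mul_comm (27 * (u * v * w)) (27 * (r * s * t)),
      mul_comm ((u + v + w) ^ 3) ((r + s + t) ^ 3)]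

lemma harmonic_le {u v h : ℝ} (hu : 0 < u) (hv : 0 < v) (hh : 0 < h) :
    4 * (1 / (h * (u + v))) ≤ (1 / u + 1 / v) / h := by
  rw [div_add_div _ _ hu.ne' hv.ne', div_div, mul_one_div, div_le_div_iff₀ (by positivity)
    (by positivity)]
  nlinarith [mul_nonneg hh.le (sq_nonneg (u - v))]

lemma volume_product_bound {u v w r s t d : ℝ} (hu : 0 < u) (hv : 0 < v) (hw : 0 < w)
    (hr : 0 < r) (hs : 0 < s) (ht : 0 < t) (hd : u + v + w = 2 * d) :
    27 / 4 ≤ ((r + s + t) / 2) *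
        (d * ((1 / u + 1 / v) / r + (1 / v + 1 / w) / s + (1 / w + 1 / u) / t) / 2) ∧
      (((r + s + t) / 2) *
        (d * ((1 / u + 1 / v) / r + (1 / v + 1 / w) / s + (1 / w + 1 / u) / t) / 2) ≤ 27 / 4 →
        (u = v ∧ v = w) ∧ r = s ∧ s = t) := by
  have hd0 : 0 < d := by linarith
  have h1 := harmonic_le hu hv hr
  have h2 := harmonic_le hv hw hs
  have h3 := harmonic_le hw hu ht
  have key : (r + s + t) * ((u + v) + (v + w) + (w + u)) *
      (1 / (r * (u + v)) + 1 / (s * (v + w)) + 1 / (t * (w + u))) / 4 ≤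
      ((r + s + t) / 2) *
        (d * ((1 / u + 1 / v) / r + (1 / v + 1 / w) / s + (1 / w + 1 / u) / t) / 2) := by
    calc _ = ((r + s + t) / 2) * (d * (4 * (1 / (r * (u + v))) + 4 * (1 / (s * (v + w))) +
        4 * (1 / (t * (w + u)))) / 2) := by
          rw [show (u + v) + (v + w) + (w + u) = 4 * d by linarith]; ring
      _ ≤ _ := by gcongr
  refine ⟨?_, fun h => ?_⟩
  · have := le_sum_mul_sum_mul_sum hr hs ht (add_pos hu hv) (add_pos hv hw) (add_pos hw hu)
    linarith
  · obtain ⟨h4, h5, h6⟩ := eq_of_sum_mul_sum_mul_sum_le hr hs ht (add_pos hu hv) (add_pos hv hw)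
      (add_pos hw hu) (by linarith)
    exact ⟨⟨by linarith, by linarith⟩, h4⟩

lemma isClosed_polarBody (K : Set ℂ) : IsClosed (polarBody K) := by
  have : polarBody K = ⋂ y ∈ K, {x | ⟪x, y⟫ ≤ 1} := by ext; simp [polarBody]
  rw [this]
  exact isClosed_biInter fun y _ => isClosed_le (by fun_prop) continuous_const

lemma convex_inner_le_one (y : ℂ) : Convex ℝ {x : ℂ | ⟪x, y⟫ ≤ 1} := by
  intro a ha b hb s t hs ht hst
  simp only [Set.mem_ofPred_eq] at ha hb ⊢
  rw [inner_add_left, real_inner_smul_left, real_inner_smul_left]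
  nlinarith

lemma convex_polarBody (K : Set ℂ) : Convex ℝ (polarBody K) := by
  have : polarBody K = ⋂ y ∈ K, {x | ⟪x, y⟫ ≤ 1} := by ext; simp [polarBody]
  rw [this]
  exact convex_iInter₂ fun y _ => convex_inner_le_one y

lemma isConvexBody_polarBody {K : Set ℂ} (hK : IsConvexBody K) (ho : (0 : ℂ) ∈ interior K) :
    IsConvexBody (polarBody K) := by
  refine ⟨convex_polarBody K, ?_, ?_⟩
  · obtain ⟨ε, hε, hball⟩ := Metric.mem_nhds_iff.1 (mem_interior_iff_mem_nhds.1 ho)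
    refine (isCompact_closedBall (0 : ℂ) (2 / ε)).of_isClosed_subset (isClosed_polarBody K) ?_
    intro x hx
    rw [mem_closedBall_zero_iff]
    rcases eq_or_ne x 0 with rfl | hx0
    · simp only [norm_zero]; positivity
    have hn : 0 < ‖x‖ := norm_pos_iff.2 hx0
    have hmem : (ε / (2 * ‖x‖)) • x ∈ K := by
      apply hball
      rw [mem_ball_zero_iff, norm_smul, Real.norm_of_nonneg (by positivity)]
      have : ε / (2 * ‖x‖) * ‖x‖ = ε / 2 := by field_simp
      linarith
    have h1 := hx _ hmem
    rw [real_inner_smul_right, real_inner_self_eq_norm_sq] at h1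
    have h2 : ε / (2 * ‖x‖) * ‖x‖ ^ 2 = ε * ‖x‖ / 2 := by field_simp
    rw [le_div_iff₀ hε]
    linarith
  · obtain ⟨R, hR⟩ := hK.2.1.isBounded.exists_norm_le
    have hR0 : 0 ≤ R := (norm_nonneg _).trans (hR 0 (interior_subset ho))
    refine ⟨0, mem_interior_iff_mem_nhds.2 (Filter.mem_of_superset
      (Metric.ball_mem_nhds 0 (show 0 < 1 / (R + 1) by positivity)) ?_)⟩
    intro x hx y hy
    rw [mem_ball_zero_iff, lt_div_iff₀ (by positivity)] at hx
    have := real_inner_le_norm x y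
    nlinarith [hR y hy, norm_nonneg x]

lemma mem_of_forall_mem_polarBody {K : Set ℂ} (hconv : Convex ℝ K) (hcl : IsClosed K)
    (h0 : (0 : ℂ) ∈ K) {e : ℂ} (he : ∀ y ∈ polarBody K, ⟪y, e⟫ ≤ 1) : e ∈ K := by
  by_contra hne
  obtain ⟨f, u, hf, hu⟩ := geometric_hahn_banach_closed_point hconv hcl hne
  have hu0 : 0 < u := by simpa using hf 0 h0
  set w := (InnerProductSpace.toDual ℝ ℂ).symm f
  have hw : ∀ x, ⟪w, x⟫ = f x := fun x => InnerProductSpace.toDual_symm_apply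
  have hmem : (u⁻¹ • w) ∈ polarBody K := by
    intro y hy
    rw [real_inner_smul_left, hw, inv_mul_le_iff₀ hu0, mul_one]
    exact (hf y hy).le
  have h1 := he _ hmem
  rw [real_inner_smul_left, hw, inv_mul_le_iff₀ hu0, mul_one] at h1
  linarith

/-- The vector `v` rotated by a right angle and divided by `t`: the polar dual of the line
`{p | crossProd v p = t}`. -/
noncomputable def dualPoint (v : ℂ) (t : ℝ) : ℂ := ⟨-v.im / t, v.re / t⟩

lemma inner_dualPoint (v p : ℂ) (t : ℝ) : ⟪dualPoint v t, p⟫ = crossProd v p / t := by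
  rw [inner_eq_re_im, dualPoint, crossProd]
  ring

lemma dualPoint_mem_polarBody {K : Set ℂ} {v : ℂ} {t : ℝ} (ht : 0 < t)
    (h : ∀ p ∈ K, crossProd v p ≤ t) : dualPoint v t ∈ polarBody K := by
  intro p hp
  rw [inner_dualPoint, div_le_one ht]
  exact h p hp

lemma exists_crossProd_pos {K : Set ℂ} (ho : (0 : ℂ) ∈ interior K) {v : ℂ} (hv : v ≠ 0) :
    ∃ p ∈ K, 0 < crossProd v p := by
  have hcont : Continuous fun t : ℝ => t • (⟨-v.im, v.re⟩ : ℂ) := by fun_prop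
  have hev : ∀ᶠ t : ℝ in nhds 0, t • (⟨-v.im, v.re⟩ : ℂ) ∈ K := by
    refine hcont.continuousAt.eventually_mem ?_
    rw [zero_smul]
    exact mem_interior_iff_mem_nhds.1 ho
  obtain ⟨ε, hε, hball⟩ := Metric.eventually_nhds_iff.1 hev
  refine ⟨_, hball (y := ε / 2) (by
    rw [Real.dist_eq, sub_zero, abs_of_pos (by linarith)]; linarith), ?_⟩
  have : crossProd v ((ε / 2) • (⟨-v.im, v.re⟩ : ℂ)) = ε / 2 * (v.re ^ 2 + v.im ^ 2) := by
    simp only [crossProd, Complex.real_smul, Complex.mul_re, Complex.mul_im, Complex.ofReal_re,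
      Complex.ofReal_im]
    ring
  rw [this]
  have h2 : 0 < v.re ^ 2 + v.im ^ 2 := by
    have := Complex.normSq_pos.2 hv
    rw [Complex.normSq_apply] at this
    linarith
  positivity

lemma signedArea_eq_sub_crossProd (a b p : ℂ) :
    signedArea a b p = crossProd a b - crossProd (a - b) p := by
  simp only [signedArea, crossProd, Complex.sub_re, Complex.sub_im]; ring

lemma signedArea_eq_crossProd_add (a b c : ℂ) :
    signedArea a b c = crossProd a b + crossProd b c + crossProd c a := by
  simp only [signedArea, crossProd, Complex.sub_re, Complex.sub_im]; ring

lemma crossProd_self (a : ℂ) : crossProd a a = 0 := by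
  simp only [crossProd]; ring

lemma signedArea_dual_triangle (a b c : ℂ) {u v w : ℝ} (hu : u ≠ 0) (hv : v ≠ 0) (hw : w ≠ 0) :
    signedArea (dualPoint (c - b) u) (dualPoint (a - c) v) (dualPoint (b - a) w) =
      signedArea a b c * (u + v + w) / (u * v * w) := by
  simp only [signedArea, crossProd, dualPoint, Complex.sub_re, Complex.sub_im]
  field_simp
  ring

lemma signedArea_dual_tip (a b c : ℂ) {u v h : ℝ} (hu : u ≠ 0) (hv : v ≠ 0) (hh : h ≠ 0) :
    signedArea (dualPoint (c - b) u) (dualPoint (a - c) v) (dualPoint (a - b) h) =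
      signedArea a b c / (u * v) - signedArea a b c * ((1 / u + 1 / v) / h) := by
  simp only [signedArea, crossProd, dualPoint, Complex.sub_re, Complex.sub_im]
  field_simp
  ring

lemma signedArea_dual_next (a b c : ℂ) {v w h : ℝ} (hv : v ≠ 0) (hw : w ≠ 0) (hh : h ≠ 0) :
    signedArea (dualPoint (a - c) v) (dualPoint (b - a) w) (dualPoint (a - b) h) =
      signedArea a b c * (1 / (v * w) + 1 / (v * h)) := by
  simp only [signedArea, crossProd, dualPoint, Complex.sub_re, Complex.sub_im]
  field_simp
  ring

lemma signedArea_dual_prev (a b c : ℂ) {u w h : ℝ} (hu : u ≠ 0) (hw : w ≠ 0) (hh : h ≠ 0) :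
    signedArea (dualPoint (b - a) w) (dualPoint (c - b) u) (dualPoint (a - b) h) =
      signedArea a b c * (1 / (w * u) + 1 / (u * h)) := by
  simp only [signedArea, crossProd, dualPoint, Complex.sub_re, Complex.sub_im]
  field_simp
  ring

lemma continuous_signedArea : Continuous fun q : ℂ × ℂ × ℂ => signedArea q.1 q.2.1 q.2.2 := by
  unfold signedArea crossProd
  fun_prop

/-- `a b c` is an inscribed triangle of `K` of maximal area, and `x`, `y`, `z` are points of `K`
farthest outwards from the sides `ab`, `bc`, `ca`. -/
structure IsMaxTriangle (K : Set ℂ) (a b c x y z : ℂ) : Prop where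
  ha : a ∈ K
  hb : b ∈ K
  hc : c ∈ K
  hx : x ∈ K
  hy : y ∈ K
  hz : z ∈ K
  pos : 0 < signedArea a b c
  max : ∀ p ∈ K, ∀ q ∈ K, ∀ r ∈ K, signedArea p q r ≤ signedArea a b c
  min_x : ∀ p ∈ K, signedArea a b x ≤ signedArea a b p
  min_y : ∀ p ∈ K, signedArea b c y ≤ signedArea b c p
  min_z : ∀ p ∈ K, signedArea c a z ≤ signedArea c a p

lemma exists_isMaxTriangle {K : Set ℂ} (hK : IsConvexBody K) (ho : (0 : ℂ) ∈ interior K) :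
    ∃ a b c x y z, IsMaxTriangle K a b c x y z := by
  obtain ⟨-, hcomp, -⟩ := hK
  have h0 : (0 : ℂ) ∈ K := interior_subset ho
  obtain ⟨⟨a, b, c⟩, ⟨ha, hb, hc⟩, hmax⟩ := (hcomp.prod (hcomp.prod hcomp)).exists_isMaxOn
    ⟨(0, 0, 0), h0, h0, h0⟩ continuous_signedArea.continuousOn
  have hmax' : ∀ p ∈ K, ∀ q ∈ K, ∀ r ∈ K, signedArea p q r ≤ signedArea a b c :=
    fun p hp q hq r hr => hmax (show (p, q, r) ∈ K ×ˢ (K ×ˢ K) from ⟨hp, hq, hr⟩)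
  have hmin : ∀ a b : ℂ, ∃ x ∈ K, ∀ p ∈ K, signedArea a b x ≤ signedArea a b p := by
    intro a b
    obtain ⟨x, hx, hx'⟩ := hcomp.exists_isMinOn ⟨0, h0⟩
      (f := fun p => signedArea a b p) (by unfold signedArea crossProd; fun_prop)
    exact ⟨x, hx, fun p hp => hx' hp⟩
  obtain ⟨x, hx, hx'⟩ := hmin a b
  obtain ⟨y, hy, hy'⟩ := hmin b c
  obtain ⟨z, hz, hz'⟩ := hmin c a
  refine ⟨a, b, c, x, y, z, ha, hb, hc, hx, hy, hz, ?_, hmax', hx', hy', hz'⟩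
  obtain ⟨p, hp, hp1⟩ := exists_crossProd_pos ho one_ne_zero
  have hp0 : p ≠ 0 := by
    rintro rfl
    simp [crossProd] at hp1
  obtain ⟨q, hq, hq1⟩ := exists_crossProd_pos ho hp0
  refine lt_of_lt_of_le ?_ (hmax' 0 h0 p hp q hq)
  simpa [signedArea] using hq1

namespace IsMaxTriangle

variable {K : Set ℂ} {a b c x y z : ℂ}

lemma rotate (h : IsMaxTriangle K a b c x y z) : IsMaxTriangle K b c a y z x where
  ha := h.hb
  hb := h.hc
  hc := h.ha
  hx := h.hy
  hy := h.hz
  hz := h.hx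
  pos := (signedArea_rotate a b c).symm ▸ h.pos
  max := (signedArea_rotate a b c).symm ▸ h.max
  min_x := h.min_y
  min_y := h.min_z
  min_z := h.min_x

lemma signedArea_tip_nonpos (h : IsMaxTriangle K a b c x y z) : signedArea a b x ≤ 0 :=
  (h.min_x a h.ha).trans (signedArea_self_left a b).le

lemma signedArea_next_nonneg (h : IsMaxTriangle K a b c x y z) : 0 ≤ signedArea b c x := by
  have h1 := signedArea_add_add a b c x
  have h2 := h.max c h.hc a h.ha x h.hx
  linarith [h.signedArea_tip_nonpos]

lemma signedArea_prev_nonneg (h : IsMaxTriangle K a b c x y z) : 0 ≤ signedArea c a x := by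
  have h1 := signedArea_add_add a b c x
  have h2 := h.max b h.hb c h.hc x h.hx
  linarith [h.signedArea_tip_nonpos]

lemma neg_le_signedArea (h : IsMaxTriangle K a b c x y z) :
    -signedArea a b c ≤ signedArea a b x := by
  have h1 := signedArea_add_add a b c x
  have h2 := h.max b h.hb c h.hc x h.hx
  have h3 := h.max c h.hc a h.ha x h.hx
  linarith

lemma ne (h : IsMaxTriangle K a b c x y z) : a ≠ b := by
  rintro rfl
  have := h.pos
  simp [signedArea, crossProd] at this

lemma height_pos (h : IsMaxTriangle K a b c x y z) (ho : (0 : ℂ) ∈ interior K) :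
    0 < crossProd a b - signedArea a b x := by
  obtain ⟨p, hp, hp1⟩ := exists_crossProd_pos ho (sub_ne_zero.2 h.ne)
  have := h.min_x p hp
  rw [signedArea_eq_sub_crossProd a b p] at this
  linarith

lemma crossProd_lt (h : IsMaxTriangle K a b c x y z) (ho : (0 : ℂ) ∈ interior K) :
    0 < signedArea a b c - crossProd a b := by
  obtain ⟨p, hp, hp1⟩ := exists_crossProd_pos ho (sub_ne_zero.2 h.ne.symm)
  have h1 := h.max a h.ha b h.hb p hp
  rw [signedArea_eq_sub_crossProd a b p] at h1
  have h2 : crossProd (b - a) p = -crossProd (a - b) p := by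
    simp only [crossProd, Complex.sub_re, Complex.sub_im]; ring
  linarith

lemma dualPoint_side_mem (h : IsMaxTriangle K a b c x y z) (ho : (0 : ℂ) ∈ interior K) :
    dualPoint (b - a) (signedArea a b c - crossProd a b) ∈ polarBody K := by
  refine dualPoint_mem_polarBody (h.crossProd_lt ho) fun p hp => ?_
  have h1 := h.max a h.ha b h.hb p hp
  rw [signedArea_eq_sub_crossProd a b p] at h1
  have h2 : crossProd (b - a) p = -crossProd (a - b) p := by
    simp only [crossProd, Complex.sub_re, Complex.sub_im]; ring
  linarith

lemma dualPoint_tip_mem (h : IsMaxTriangle K a b c x y z) (ho : (0 : ℂ) ∈ interior K) :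
    dualPoint (a - b) (crossProd a b - signedArea a b x) ∈ polarBody K := by
  refine dualPoint_mem_polarBody (h.height_pos ho) fun p hp => ?_
  have h1 := h.min_x p hp
  rw [signedArea_eq_sub_crossProd a b p] at h1
  linarith

lemma le_area (h : IsMaxTriangle K a b c x y z) (hK : IsConvexBody K) :
    ((crossProd a b - signedArea a b x) + (crossProd b c - signedArea b c y) +
      (crossProd c a - signedArea c a z)) / 2 ≤ area K := by
  have h1 := area_mono hK.2.1
    (triangleStar_subset hK.1 h.ha h.hb h.hc h.hx h.hy h.hz)
  rw [area_triangleStar h.pos h.signedArea_tip_nonpos h.signedArea_next_nonneg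
    h.signedArea_prev_nonneg h.rotate.signedArea_prev_nonneg h.rotate.signedArea_tip_nonpos
    h.rotate.signedArea_next_nonneg h.rotate.rotate.signedArea_next_nonneg
    h.rotate.rotate.signedArea_prev_nonneg h.rotate.rotate.signedArea_tip_nonpos,
    signedArea_eq_crossProd_add a b c] at h1
  linarith

end IsMaxTriangle

/-- The hexagon dual to a maximal triangle of `K` with outermost heights `r`, `s`, `t`. -/
noncomputable def dualStar (a b c : ℂ) (u v w r s t : ℝ) : Set ℂ :=
  triangleStar (dualPoint (c - b) u) (dualPoint (a - c) v) (dualPoint (b - a) w)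
    (dualPoint (a - b) r) (dualPoint (b - c) s) (dualPoint (c - a) t)

lemma signedArea_dual_tip_nonpos {a b c : ℂ} {u v h : ℝ} (hpos : 0 < signedArea a b c)
    (hu : 0 < u) (hv : 0 < v) (hh : 0 < h) (hle : h ≤ u + v) :
    signedArea (dualPoint (c - b) u) (dualPoint (a - c) v) (dualPoint (a - b) h) ≤ 0 := by
  rw [signedArea_dual_tip a b c hu.ne' hv.ne' hh.ne']
  have : signedArea a b c / (u * v) - signedArea a b c * ((1 / u + 1 / v) / h) =
      -(signedArea a b c * (u + v - h) / (u * v * h)) := by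
    field_simp
    ring
  rw [this, neg_nonpos]
  have := sub_nonneg.2 hle
  positivity

lemma area_dualStar {a b c : ℂ} {u v w r s t : ℝ} (hpos : 0 < signedArea a b c)
    (hu : 0 < u) (hv : 0 < v) (hw : 0 < w) (hr : 0 < r) (hs : 0 < s) (ht : 0 < t)
    (hru : r ≤ u + v) (hsv : s ≤ v + w) (htw : t ≤ w + u) :
    area (dualStar a b c u v w r s t) =
      signedArea a b c * ((1 / u + 1 / v) / r + (1 / v + 1 / w) / s + (1 / w + 1 / u) / t) / 2 := by
  have hbca : 0 < signedArea b c a := (signedArea_rotate a b c).symm ▸ hpos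
  have hcab : 0 < signedArea c a b := (signedArea_rotate b c a).symm ▸ hbca
  rw [dualStar, area_triangleStar]
  · rw [signedArea_dual_triangle a b c hu.ne' hv.ne' hw.ne',
      signedArea_dual_tip a b c hu.ne' hv.ne' hr.ne',
      signedArea_dual_tip b c a hv.ne' hw.ne' hs.ne',
      signedArea_dual_tip c a b hw.ne' hu.ne' ht.ne',
      signedArea_rotate b c a, signedArea_rotate a b c]
    field_simp
    ring
  · rw [signedArea_dual_triangle a b c hu.ne' hv.ne' hw.ne']
    positivity
  · exact signedArea_dual_tip_nonpos hpos hu hv hr hru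
  · rw [signedArea_dual_next a b c hv.ne' hw.ne' hr.ne']
    positivity
  · rw [signedArea_dual_prev a b c hu.ne' hw.ne' hr.ne']
    positivity
  · rw [signedArea_dual_prev b c a hv.ne' hu.ne' hs.ne']
    positivity
  · exact signedArea_dual_tip_nonpos hbca hv hw hs hsv
  · rw [signedArea_dual_next b c a hw.ne' hu.ne' hs.ne']
    positivity
  · rw [signedArea_dual_next c a b hu.ne' hv.ne' ht.ne']
    positivity
  · rw [signedArea_dual_prev c a b hw.ne' hv.ne' ht.ne']
    positivity
  · exact signedArea_dual_tip_nonpos hcab hw hu ht htw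

namespace IsMaxTriangle

variable {K : Set ℂ} {a b c x y z : ℂ}

lemma height_le (h : IsMaxTriangle K a b c x y z) :
    crossProd a b - signedArea a b x ≤
      (signedArea a b c - crossProd b c) + (signedArea a b c - crossProd c a) := by
  linarith [h.neg_le_signedArea, signedArea_eq_crossProd_add a b c]

lemma dualStar_subset (h : IsMaxTriangle K a b c x y z) (ho : (0 : ℂ) ∈ interior K) :
    dualStar a b c (signedArea a b c - crossProd b c) (signedArea a b c - crossProd c a)
      (signedArea a b c - crossProd a b) (crossProd a b - signedArea a b x)
      (crossProd b c - signedArea b c y) (crossProd c a - signedArea c a z) ⊆ polarBody K := by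
  have hbca := signedArea_rotate a b c
  have hcab := (signedArea_rotate b c a).trans hbca
  refine triangleStar_subset (convex_polarBody K) ?_ ?_ (h.dualPoint_side_mem ho)
    (h.dualPoint_tip_mem ho) (h.rotate.dualPoint_tip_mem ho) (h.rotate.rotate.dualPoint_tip_mem ho)
  · simpa only [hbca] using h.rotate.dualPoint_side_mem ho
  · simpa only [hcab] using h.rotate.rotate.dualPoint_side_mem ho

end IsMaxTriangle

/-- When `0` is the centroid of `a b c` and all the heights agree, the polar of the dual hexagon
has a vertex on the line through `a` parallel to `bc`. -/
lemma inner_le_one_of_mem_dualStar {a b c p : ℂ} {d h : ℝ} (hd : 0 < d)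
    (hab : crossProd a b = d) (hbc : crossProd b c = d) (hca : crossProd c a = d)
    (h1 : d ≤ h) (h4 : h ≤ 4 * d)
    (hp : p ∈ dualStar a b c (2 * d) (2 * d) (2 * d) h h h) :
    ⟪p, ((h + 2 * d) / (3 * d)) • a + (2 * (h - d) / (3 * d)) • b⟫ ≤ 1 := by
  have hh : 0 < h := hd.trans_le h1
  have key : ∀ v : ℂ, ∀ t : ℝ,
      ⟪dualPoint v t, ((h + 2 * d) / (3 * d)) • a + (2 * (h - d) / (3 * d)) • b⟫ =
      ((h + 2 * d) * crossProd v a + 2 * (h - d) * crossProd v b) / (3 * d) / t := by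
    intro v t
    rw [inner_add_right, real_inner_smul_right, real_inner_smul_right, inner_dualPoint,
      inner_dualPoint]
    ring
  have sub : ∀ u v w : ℂ, crossProd (u - v) w = crossProd u w - crossProd v w := by
    intro u v w
    simp only [crossProd, Complex.sub_re, Complex.sub_im]; ring
  have swap : ∀ u v : ℂ, crossProd u v = -crossProd v u := by
    intro u v
    simp only [crossProd]; ring
  have hba : crossProd b a = -d := by rw [swap, hab]
  have hcb : crossProd c b = -d := by rw [swap, hbc]
  refine triangleStar_subset (convex_inner_le_one _) ?_ ?_ ?_ ?_ ?_ ?_ hp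
  all_goals
    rw [Set.mem_ofPred_eq, key]
    simp only [sub, hab, hca, hba, hcb, crossProd_self]
    rw [div_div, div_le_one (by positivity)]
    nlinarith [mul_le_mul_of_nonneg_left h1 hd.le, mul_le_mul_of_nonneg_left h4 hd.le]

lemma dualStar_rotate (a b c : ℂ) (u v w r s t : ℝ) :
    dualStar b c a v w u s t r = dualStar a b c u v w r s t := by
  have hset : ∀ u v w : ℂ, ({v, w, u} : Set ℂ) = {u, v, w} := by
    intro u v w
    ext q
    simp only [Set.mem_insert_iff, Set.mem_singleton_iff]
    tauto
  ext p
  simp only [dualStar, triangleStar, Set.mem_union, hset (dualPoint (c - b) u)]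
  tauto

lemma add_add_eq_zero_of_crossProd {a b c : ℂ} {d : ℝ} (hd : d ≠ 0)
    (hab : crossProd a b = d) (hbc : crossProd b c = d) (hca : crossProd c a = d) :
    a + b + c = 0 := by
  simp only [crossProd] at hab hbc hca
  have hre : d * (a + b + c).re = 0 := by
    simp only [Complex.add_re]
    linear_combination (-c.re) * hab - a.re * hbc - b.re * hca
  have him : d * (a + b + c).im = 0 := by
    simp only [Complex.add_im]
    linear_combination (-c.im) * hab - a.im * hbc - b.im * hca
  exact Complex.ext (by simpa [hd] using hre) (by simpa [hd] using him)

lemma affineIndependent_iff_signedArea_ne_zero (a b c : ℂ) :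
    AffineIndependent ℝ ![a, b, c] ↔ signedArea a b c ≠ 0 := by
  rw [affineIndependent_iff_not_collinear_set, not_iff_not,
    collinear_iff_of_mem (p₀ := a) (by simp)]
  constructor
  · rintro ⟨v, hv⟩
    obtain ⟨r, hr⟩ := hv b (by simp)
    obtain ⟨s, hs⟩ := hv c (by simp)
    rw [hr, hs]
    simp only [signedArea, crossProd, vadd_eq_add, add_sub_cancel_right, Complex.real_smul,
      Complex.mul_re, Complex.mul_im, Complex.ofReal_re, Complex.ofReal_im]
    ring
  · intro h
    rcases eq_or_ne b a with rfl | hne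
    · refine ⟨c - b, ?_⟩
      rintro p (rfl | rfl | rfl)
      · exact ⟨0, by simp⟩
      · exact ⟨0, by simp⟩
      · exact ⟨1, by simp⟩
    · refine ⟨b - a, ?_⟩
      have hn : 0 < (b.re - a.re) ^ 2 + (b.im - a.im) ^ 2 := by
        have := Complex.normSq_pos.2 (sub_ne_zero.2 hne)
        rw [Complex.normSq_apply, Complex.sub_re, Complex.sub_im] at this
        linarith
      rintro p (rfl | rfl | rfl)
      · exact ⟨0, by simp⟩
      · exact ⟨1, by simp⟩
      · simp only [signedArea, crossProd, Complex.sub_re, Complex.sub_im] at h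
        refine ⟨((p.re - a.re) * (b.re - a.re) + (p.im - a.im) * (b.im - a.im)) /
          ((b.re - a.re) ^ 2 + (b.im - a.im) ^ 2), ?_⟩
        apply Complex.ext
        · simp only [vadd_eq_add, Complex.add_re, Complex.real_smul, Complex.mul_re,
            Complex.ofReal_re, Complex.ofReal_im, Complex.sub_re, Complex.sub_im]
          field_simp
          linear_combination (-(b.im - a.im)) * h
        · simp only [vadd_eq_add, Complex.add_im, Complex.real_smul, Complex.mul_im,
            Complex.ofReal_re, Complex.ofReal_im, Complex.sub_re, Complex.sub_im]
          field_simp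
          linear_combination (b.re - a.re) * h

lemma area_mul_area_polarBody_bound {K : Set ℂ} (hK : IsConvexBody K)
    (ho : (0 : ℂ) ∈ interior K) :
    27 / 4 ≤ area K * area (polarBody K) ∧
      (area K * area (polarBody K) ≤ 27 / 4 → IsTriangleCentroidZero K) := by
  obtain ⟨a, b, c, x, y, z, h⟩ := exists_isMaxTriangle hK ho
  have hbca := signedArea_rotate a b c
  have hcab := (signedArea_rotate b c a).trans hbca
  have hw := h.crossProd_lt ho
  have hu := h.rotate.crossProd_lt ho
  have hv := h.rotate.rotate.crossProd_lt ho
  have hr := h.height_pos ho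
  have hs := h.rotate.height_pos ho
  have ht := h.rotate.rotate.height_pos ho
  have hru := h.height_le
  have hsv := h.rotate.height_le
  have htw := h.rotate.rotate.height_le
  have hK1 := h.le_area hK
  have hsub := h.dualStar_subset ho
  rw [hbca] at hu hsv
  rw [hcab] at hv htw
  have hsum := signedArea_eq_crossProd_add a b c
  have hpos := h.pos
  have hstar := area_dualStar hpos hu hv hw hr hs ht hru hsv htw
  have hpolar := isConvexBody_polarBody hK ho
  have hK2 := area_mono hpolar.2.1 hsub
  obtain ⟨hb1, hb2⟩ := volume_product_bound hu hv hw hr hs ht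
    (d := signedArea a b c) (by linarith)
  rw [← hstar] at hb1 hb2
  have hP0 : 0 < area (dualStar a b c (signedArea a b c - crossProd b c)
      (signedArea a b c - crossProd c a) (signedArea a b c - crossProd a b)
      (crossProd a b - signedArea a b x) (crossProd b c - signedArea b c y)
      (crossProd c a - signedArea c a z)) := by
    rw [hstar]; positivity
  have hS0 : 0 < ((crossProd a b - signedArea a b x) + (crossProd b c - signedArea b c y) +
      (crossProd c a - signedArea c a z)) / 2 := by positivity
  have hmul := mul_le_mul hK1 hK2 hP0.le (hS0.le.trans hK1)
  refine ⟨hb1.trans hmul, fun heq => ?_⟩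
  obtain ⟨⟨huv, hvw⟩, hrs, hst⟩ := hb2 (hmul.trans heq)
  have hfull : area (polarBody K) ≤ area (dualStar a b c (signedArea a b c - crossProd b c)
      (signedArea a b c - crossProd c a) (signedArea a b c - crossProd a b)
      (crossProd a b - signedArea a b x) (crossProd b c - signedArea b c y)
      (crossProd c a - signedArea c a z)) := by
    by_contra! hlt
    have h1 := mul_lt_mul_of_pos_left hlt hS0
    have h2 := mul_le_mul_of_nonneg_right hK1 (hP0.trans hlt).le
    linarith
  have hpolar_eq := eq_of_subset_of_area_le hpolar (isCompact_triangleStar _ _ _ _ _ _).isClosed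
    hsub hfull
  obtain ⟨d, hd⟩ : ∃ d, crossProd a b = d := ⟨_, rfl⟩
  obtain ⟨k, hk⟩ : ∃ k, crossProd a b - signedArea a b x = k := ⟨_, rfl⟩
  have hbc : crossProd b c = d := by linarith
  have hca : crossProd c a = d := by linarith
  have hΔ : signedArea a b c = 3 * d := by linarith
  have hd0 : 0 < d := by linarith
  have hk2 : crossProd b c - signedArea b c y = k := by linarith
  have hk3 : crossProd c a - signedArea c a z = k := by linarith
  have hdk : d ≤ k := by linarith [h.signedArea_tip_nonpos]
  have hk4 : k ≤ 4 * d := by linarith [h.neg_le_signedArea]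
  have h2d : 3 * d - d = 2 * d := by ring
  rw [hk, hk2, hk3, hd, hbc, hca, hΔ, h2d] at hpolar_eq
  have hp1 : ∀ p ∈ polarBody K, p ∈ dualStar a b c (2 * d) (2 * d) (2 * d) k k k :=
    fun p hp => hpolar_eq.symm.subset hp
  have hp2 : ∀ p ∈ polarBody K, p ∈ dualStar b c a (2 * d) (2 * d) (2 * d) k k k := by
    rw [dualStar_rotate]; exact hp1
  have hp3 : ∀ p ∈ polarBody K, p ∈ dualStar c a b (2 * d) (2 * d) (2 * d) k k k := by
    rw [dualStar_rotate]; exact hp2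
  have hcl := hK.2.1.isClosed
  have h0 := interior_subset ho
  have e1 : ((k + 2 * d) / (3 * d)) • a + (2 * (k - d) / (3 * d)) • b ∈ K :=
    mem_of_forall_mem_polarBody hK.1 hcl h0 fun p hp =>
      inner_le_one_of_mem_dualStar hd0 hd hbc hca hdk hk4 (hp1 p hp)
  have e2 : ((k + 2 * d) / (3 * d)) • b + (2 * (k - d) / (3 * d)) • c ∈ K :=
    mem_of_forall_mem_polarBody hK.1 hcl h0 fun p hp =>
      inner_le_one_of_mem_dualStar hd0 hbc hca hd hdk hk4 (hp2 p hp)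
  have e3 : ((k + 2 * d) / (3 * d)) • c + (2 * (k - d) / (3 * d)) • a ∈ K :=
    mem_of_forall_mem_polarBody hK.1 hcl h0 fun p hp =>
      inner_le_one_of_mem_dualStar hd0 hca hd hbc hdk hk4 (hp3 p hp)
  have hcent := add_add_eq_zero_of_crossProd hd0.ne' hd hbc hca
  have hkd : k = d := by
    have hmax := h.max _ e1 _ e2 _ e3
    have harea : ∀ s t : ℝ, signedArea (s • a + t • b) (s • b + t • c) (s • c + t • a) =
        (s ^ 2 - s * t + t ^ 2) * signedArea a b c := by
      intro s t
      simp only [signedArea, crossProd, Complex.add_re, Complex.add_im, Complex.sub_re,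
        Complex.sub_im, Complex.real_smul, Complex.mul_re, Complex.mul_im, Complex.ofReal_re,
        Complex.ofReal_im]
      ring
    rw [harea] at hmax
    have hle := le_of_mul_le_mul_right (hmax.trans_eq (one_mul _).symm) hpos
    have hval : ((k + 2 * d) / (3 * d)) ^ 2 -
        (k + 2 * d) / (3 * d) * (2 * (k - d) / (3 * d)) + (2 * (k - d) / (3 * d)) ^ 2 =
        1 + (k - d) ^ 2 / (3 * d ^ 2) := by
      field_simp
      ring
    rw [hval] at hle
    have h3 : (k - d) ^ 2 / (3 * d ^ 2) ≤ 0 := by linarith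
    have h4 : (k - d) ^ 2 ≤ 0 := by
      by_contra! hc
      have : 0 < (k - d) ^ 2 / (3 * d ^ 2) := by positivity
      linarith
    have := pow_eq_zero_iff two_ne_zero |>.1 (le_antisymm h4 (sq_nonneg _))
    linarith
  refine ⟨a, b, c, (affineIndependent_iff_signedArea_ne_zero a b c).2 hpos.ne', ?_, ?_⟩
  · refine Set.Subset.antisymm (fun p hp => (mem_triangle_iff hpos p).2 ⟨?_, ?_, ?_⟩)
      (triangle_subset hK.1 h.ha h.hb h.hc)
    · linarith [h.min_x p hp]
    · linarith [h.min_y p hp]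
    · linarith [h.min_z p hp]
  · rw [hcent, zero_div]

lemma polarBody_triangle {a b c : ℂ} {d : ℝ} (hd : 0 < d) (hab : crossProd a b = d)
    (hbc : crossProd b c = d) (hca : crossProd c a = d) :
    signedArea (dualPoint (a - b) d) (dualPoint (b - c) d) (dualPoint (c - a) d) = 9 / d ∧
    polarBody (convexHull ℝ {a, b, c}) =
      convexHull ℝ {dualPoint (a - b) d, dualPoint (b - c) d, dualPoint (c - a) d} := by
  have hsum := add_add_eq_zero_of_crossProd hd.ne' hab hbc hca
  have side : ∀ {a b c : ℂ}, a + b + c = 0 → crossProd a b = d → ∀ y : ℂ,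
      signedArea (dualPoint (a - b) d) (dualPoint (b - c) d) y = 3 / d * (1 - ⟪y, b⟫) := by
    intro a b c h h' y
    obtain rfl : c = -a - b := by linear_combination h
    rw [inner_eq_re_im]
    simp only [crossProd] at h'
    simp only [signedArea, crossProd, dualPoint, Complex.sub_re, Complex.sub_im, Complex.neg_re,
      Complex.neg_im]
    have hd' := hd.ne'
    field_simp
    linear_combination 3 * h'
  have hbca : b + c + a = 0 := by rw [← hsum]; ring
  have hcab : c + a + b = 0 := by rw [← hsum]; ring
  have harea : signedArea (dualPoint (a - b) d) (dualPoint (b - c) d) (dualPoint (c - a) d) =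
      9 / d := by
    rw [side hsum hab, inner_dualPoint]
    have : crossProd (c - a) b = -2 * d := by
      have : crossProd (c - a) b = -crossProd b c - crossProd a b := by
        simp only [crossProd, Complex.sub_re, Complex.sub_im]; ring
      rw [this, hbc, hab]; ring
    rw [this]
    field_simp
    norm_num
  refine ⟨harea, Set.ext fun y => ?_⟩
  have h3d : 0 < 3 / d := by positivity
  rw [mem_triangle_iff (by rw [harea]; positivity), side hsum hab, side hbca hbc, side hcab hca,
    mul_nonneg_iff_of_pos_left h3d, mul_nonneg_iff_of_pos_left h3d, mul_nonneg_iff_of_pos_left h3d,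
    sub_nonneg, sub_nonneg, sub_nonneg]
  constructor
  · intro hy
    exact ⟨hy b (subset_convexHull ℝ _ (by simp)), hy c (subset_convexHull ℝ _ (by simp)),
      hy a (subset_convexHull ℝ _ (by simp))⟩
  · rintro ⟨hb, hc, ha⟩ p hp
    rw [real_inner_comm]
    refine triangle_subset (convex_inner_le_one y) ?_ ?_ ?_ hp
    all_goals
      rw [Set.mem_ofPred_eq, real_inner_comm]
      assumption

lemma area_mul_area_polarBody_triangle {a b c : ℂ} (hpos : 0 < signedArea a b c)
    (hsum : a + b + c = 0) :
    area (convexHull ℝ {a, b, c}) * area (polarBody (convexHull ℝ {a, b, c})) = 27 / 4 := by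
  obtain rfl : c = -a - b := by linear_combination hsum
  have hΔ : signedArea a b (-a - b) = 3 * crossProd a b := by
    simp only [signedArea, crossProd, Complex.sub_re, Complex.sub_im, Complex.neg_re,
      Complex.neg_im]
    ring
  have hd : 0 < crossProd a b := by linarith
  obtain ⟨h1, h2⟩ := polarBody_triangle (c := -a - b) hd rfl
    (by simp only [crossProd, Complex.sub_re, Complex.sub_im, Complex.neg_re, Complex.neg_im]; ring)
    (by simp only [crossProd, Complex.sub_re, Complex.sub_im, Complex.neg_re, Complex.neg_im]; ring)
  rw [h2, area_triangle, area_triangle, h1, hΔ, abs_of_pos (by positivity),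
    abs_of_pos (by positivity)]
  field_simp
  norm_num

/-- Mahler–Meyer: for a planar convex body with `o` in its interior, `|K|·|K*| ≥ 27/4`,
with equality iff `K` is a triangle whose centroid is `o`. -/
theorem mahler_meyer (K : Set ℂ) (hK : IsConvexBody K) (ho : (0 : ℂ) ∈ interior K) :
    27 / 4 ≤ area K * area (polarBody K) ∧
      (area K * area (polarBody K) = 27 / 4 ↔ IsTriangleCentroidZero K) := by
  obtain ⟨h1, h2⟩ := area_mul_area_polarBody_bound hK ho
  refine ⟨h1, fun h => h2 h.le, ?_⟩
  rintro ⟨a, b, c, hind, rfl, hcent⟩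
  have hsum : a + b + c = 0 := by simpa using hcent
  rcases lt_or_gt_of_ne ((affineIndependent_iff_signedArea_ne_zero a b c).1 hind) with hneg | hpos
  · rw [Set.insert_comm]
    refine area_mul_area_polarBody_triangle ?_ (by rw [← hsum]; ring)
    rw [signedArea_swap]
    linarith
  · exact area_mul_area_polarBody_triangle hpos hsum
end

section
/- Let K be a convex body in ℝ². Then |K|·|((K−K)/2)*| ≥ 6, with equality if and only if K is a triangle. Here K−K = {y−z : y,z ∈ K} is the difference body, so (K−K)/2 is an o-symmetric convex body with o in its interior. -/
open MeasureTheory Pointwise Real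
open scoped RealInnerProductSpace

/-- `K` is a (nondegenerate) triangle. -/
def IsTriangle (K : Set ℂ) : Prop :=
  ∃ a b c : ℂ, AffineIndependent ℝ ![a, b, c] ∧ K = convexHull ℝ {a, b, c}


/-- The cross product of two plane vectors. -/
def cross (u v : ℂ) : ℝ := u.re * v.im - u.im * v.re

/-- The linear map of the plane sending `1` to `u` and `I` to `v`. -/
noncomputable def frameMap (u v : ℂ) : ℂ →ₗ[ℝ] ℂ where
  toFun z := z.re • u + z.im • v
  map_add' a b := by simp [add_mul]; ring
  map_smul' r a := by simp; ring

/-- The affine map of the plane sending `0`, `1`, `I` to `p`, `q`, `r`. -/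
noncomputable def frameAffine (p q r : ℂ) : ℂ →ᵃ[ℝ] ℂ :=
  (frameMap (q - p) (r - p)).toAffineMap + AffineMap.const ℝ ℂ p

/-- The open triangle with vertices `a`, `b`, `c`. -/
def openTriangle (a b c : ℂ) : Set ℂ :=
  {z | ∃ s t : ℝ, 0 < s ∧ 0 < t ∧ s + t < 1 ∧ z = a + (s • (b - a) + t • (c - a))}

lemma frameMap_apply (u v z : ℂ) : frameMap u v z = z.re • u + z.im • v := rfl

lemma frameAffine_apply (p q r z : ℂ) :
    frameAffine p q r z = frameMap (q - p) (r - p) z + p := rfl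

lemma det_frameMap (u v : ℂ) : LinearMap.det (frameMap u v) = cross u v := by
  rw [← LinearMap.det_toMatrix Complex.basisOneI, Matrix.det_fin_two]
  simp [LinearMap.toMatrix_apply, frameMap_apply, cross]
  ring

lemma cross_frameMap (u v a b : ℂ) :
    cross (frameMap u v a) (frameMap u v b) = cross u v * cross a b := by
  simp [frameMap_apply, cross]; ring

lemma volume_openTriangle_std : volume (openTriangle 0 1 Complex.I) = ENNReal.ofReal (1 / 2) := by
  have h : openTriangle 0 1 Complex.I = Complex.measurableEquivRealProd ⁻¹'
      (regionBetween (fun _ => (0 : ℝ)) (fun x => 1 - x) (Set.Ioo 0 1)) := by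
    ext z
    simp only [openTriangle, regionBetween, Set.mem_ofPred_eq, Set.mem_preimage, Set.mem_Ioo,
      Complex.measurableEquivRealProd_apply]
    constructor
    · rintro ⟨s, t, hs, ht, hst, rfl⟩
      simp
      refine ⟨⟨hs, ?_⟩, ht, ?_⟩ <;> linarith
    · rintro ⟨⟨h1, h2⟩, h3, h4⟩
      exact ⟨z.re, z.im, h1, h3, by linarith, by apply Complex.ext <;> simp⟩
  rw [h, Complex.volume_preserving_equiv_real_prod.measure_preimage_equiv,
    MeasureTheory.Measure.volume_eq_prod,
    volume_regionBetween_eq_integral (integrableOn_const (by simp)) _ measurableSet_Ioo]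
  · congr 1
    simp only [Pi.sub_apply, sub_zero]
    rw [← integral_Ioc_eq_integral_Ioo, ← intervalIntegral.integral_of_le zero_le_one]
    rw [intervalIntegral.integral_sub (by simp) (by simp)]
    norm_num
  · intro x hx; simp only [Set.mem_Ioo] at hx; linarith
  · exact (Continuous.integrableOn_Icc (by fun_prop)).mono_set Set.Ioo_subset_Icc_self

lemma volume_openTriangle (a b c : ℂ) :
    volume (openTriangle a b c) = ENNReal.ofReal (|cross (b - a) (c - a)| / 2) := by
  have h : openTriangle a b c =
      a +ᵥ (frameMap (b - a) (c - a) '' openTriangle 0 1 Complex.I) := by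
    ext z
    simp only [openTriangle, Set.mem_ofPred_eq, Set.mem_vadd_set, Set.mem_image]
    constructor
    · rintro ⟨s, t, hs, ht, hst, rfl⟩
      refine ⟨_, ⟨_, ⟨s, t, hs, ht, hst, rfl⟩, rfl⟩, ?_⟩
      simp [frameMap_apply]
    · rintro ⟨_, ⟨_, ⟨s, t, hs, ht, hst, rfl⟩, rfl⟩, rfl⟩
      refine ⟨s, t, hs, ht, hst, ?_⟩
      simp [frameMap_apply]
  rw [h, measure_vadd, Measure.addHaar_image_linearMap, det_frameMap, volume_openTriangle_std,
    ← ENNReal.ofReal_mul (abs_nonneg _)]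
  congr 1; ring

lemma openTriangle_subset {S : Set ℂ} (hS : Convex ℝ S) {a b c : ℂ} (ha : a ∈ S) (hb : b ∈ S)
    (hc : c ∈ S) : openTriangle a b c ⊆ S := by
  rintro _ ⟨s, t, hs, ht, hst, rfl⟩
  have := hS.sum_mem (t := Finset.univ) (w := ![1 - s - t, s, t]) (z := ![a, b, c])
    (by intro i _; fin_cases i <;> simp <;> linarith)
    (by simp [Fin.sum_univ_three]; ring)
    (by intro i _; fin_cases i <;> simpa)
  convert this using 1
  simp [Fin.sum_univ_three]
  ring

lemma volumeReal_openTriangle (a b c : ℂ) :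
    volume.real (openTriangle a b c) = |cross (b - a) (c - a)| / 2 := by
  rw [measureReal_def, volume_openTriangle, ENNReal.toReal_ofReal (by positivity)]

lemma volumeReal_cut {S : Set ℂ} (hS : volume S ≠ ⊤) {H : Set ℂ} (hH : IsOpen H) :
    volume.real S = volume.real (S ∩ H) + volume.real (S \ H) :=
  (measureReal_inter_add_sdiff hH.measurableSet hS).symm

lemma isOpen_halfPlane (a b c : ℝ) : IsOpen {z : ℂ | a * z.re + b * z.im < c} :=
  isOpen_lt (by fun_prop) continuous_const

lemma area_eq_volumeReal (S : Set ℂ) : area S = volume.real S := rfl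

/-- Lower bound for the area of a convex set by a triangle with three triangular caps. -/
lemma area_ge_of_caps {S : Set ℂ} (hS : Convex ℝ S) (hfin : volume S ≠ ⊤)
    (h0 : (0 : ℂ) ∈ S) (h1 : (1 : ℂ) ∈ S) (hI : Complex.I ∈ S) {u v w : ℂ}
    (hu : u ∈ S) (hv : v ∈ S) (hw : w ∈ S)
    (hu1 : u.re ≤ 0) (hv1 : v.im ≤ 0) (hv2 : 0 ≤ v.re + v.im) (hw1 : w.re ≤ 1) (hw2 : w.im ≤ 1)
    (hw3 : 1 ≤ w.re + w.im) :
    (1 - u.re - v.im + (w.re + w.im - 1)) / 2 ≤ area S := by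
  have hf : ∀ T ⊆ S, volume T ≠ ⊤ := fun T hT => measure_ne_top_of_subset hT hfin
  rw [area_eq_volumeReal, volumeReal_cut hfin (isOpen_halfPlane 1 0 0),
    volumeReal_cut (S := S \ _) (hf _ Set.sdiff_subset) (isOpen_halfPlane 0 1 0),
    volumeReal_cut (S := (S \ _) \ _) (hf _ (Set.sdiff_subset.trans Set.sdiff_subset))
      (isOpen_halfPlane 1 1 1)]
  have e1 : -u.re / 2 ≤ volume.real (S ∩ {z : ℂ | 1 * z.re + 0 * z.im < 0}) := by
    rcases hu1.eq_or_lt with h | h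
    · rw [h]; simp
    have : -u.re / 2 = volume.real (openTriangle 0 Complex.I u) := by
      rw [volumeReal_openTriangle]; simp [cross, abs_of_neg h]
    rw [this]
    refine measureReal_mono (Set.subset_inter (openTriangle_subset hS h0 hI hu) ?_)
      (hf _ Set.inter_subset_left)
    rintro _ ⟨s, t, hs, ht, hst, rfl⟩
    simp
    nlinarith
  have e2 : -v.im / 2 ≤ volume.real
      ((S \ {z : ℂ | 1 * z.re + 0 * z.im < 0}) ∩ {z : ℂ | 0 * z.re + 1 * z.im < 0}) := by
    rcases hv1.eq_or_lt with h | h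
    · rw [h]; simp
    have : -v.im / 2 = volume.real (openTriangle 0 1 v) := by
      rw [volumeReal_openTriangle]; simp [cross, abs_of_neg h]
    rw [this]
    refine measureReal_mono (Set.subset_inter (Set.subset_sdiff.2
      ⟨openTriangle_subset hS h0 h1 hv, Set.disjoint_left.2 ?_⟩) ?_)
      (hf _ (Set.inter_subset_left.trans Set.sdiff_subset))
    · rintro _ ⟨s, t, hs, ht, hst, rfl⟩
      simp
      nlinarith
    · rintro _ ⟨s, t, hs, ht, hst, rfl⟩
      simp
      nlinarith
  have e3 : (1 : ℝ) / 2 ≤ volume.real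
      (((S \ {z : ℂ | 1 * z.re + 0 * z.im < 0}) \ {z : ℂ | 0 * z.re + 1 * z.im < 0}) ∩
        {z : ℂ | 1 * z.re + 1 * z.im < 1}) := by
    have : (1 : ℝ) / 2 = volume.real (openTriangle 0 1 Complex.I) := by
      rw [volumeReal_openTriangle]; simp [cross]
    rw [this]
    refine measureReal_mono (Set.subset_inter (Set.subset_sdiff.2
      ⟨Set.subset_sdiff.2
      ⟨openTriangle_subset hS h0 h1 hI, Set.disjoint_left.2 ?_⟩, Set.disjoint_left.2 ?_⟩) ?_)
      (hf _ (Set.inter_subset_left.trans (Set.sdiff_subset.trans Set.sdiff_subset)))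
    all_goals
      rintro _ ⟨s, t, hs, ht, hst, rfl⟩
      simp
      nlinarith
  have e4 : (w.re + w.im - 1) / 2 ≤ volume.real
      (((S \ {z : ℂ | 1 * z.re + 0 * z.im < 0}) \ {z : ℂ | 0 * z.re + 1 * z.im < 0}) \
        {z : ℂ | 1 * z.re + 1 * z.im < 1}) := by
    have : (w.re + w.im - 1) / 2 = volume.real (openTriangle 1 Complex.I w) := by
      rw [volumeReal_openTriangle]
      have : cross (Complex.I - 1) (w - 1) = -(w.re + w.im - 1) := by simp [cross]; ring
      rw [this, abs_neg, abs_of_nonneg (by linarith)]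
    rw [this]
    refine measureReal_mono (Set.subset_sdiff.2 ⟨Set.subset_sdiff.2
      ⟨Set.subset_sdiff.2
      ⟨openTriangle_subset hS h1 hI hw, Set.disjoint_left.2 ?_⟩, Set.disjoint_left.2 ?_⟩,
      Set.disjoint_left.2 ?_⟩)
      (hf _ (Set.sdiff_subset.trans (Set.sdiff_subset.trans Set.sdiff_subset)))
    all_goals
      rintro _ ⟨s, t, hs, ht, hst, rfl⟩
      simp
      nlinarith
  linarith

/-- Lower bound for the area of a symmetric convex set containing a given hexagon. -/
lemma area_ge_of_hexagon {S : Set ℂ} (hS : Convex ℝ S) (hfin : volume S ≠ ⊤)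
    (hneg : -S = S) {x y d : ℝ} (hx : 0 < x) (hy : 0 < y) (hd : 0 < d)
    (h1 : (⟨x, 0⟩ : ℂ) ∈ S) (h2 : (⟨0, y⟩ : ℂ) ∈ S) (h3 : (⟨d, d⟩ : ℂ) ∈ S) :
    x * d + d * y + y * x ≤ area S := by
  have hf : ∀ T ⊆ S, volume T ≠ ⊤ := fun T hT => measure_ne_top_of_subset hT hfin
  have h1' : (⟨-x, 0⟩ : ℂ) ∈ S := by
    rw [← hneg, Set.mem_neg]; convert h1 using 1; apply Complex.ext <;> simp
  have h0 : (0 : ℂ) ∈ S := by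
    have := hS h1 h1' (a := 1 / 2) (b := 1 / 2) (by norm_num) (by norm_num) (by norm_num)
    convert this using 1
    apply Complex.ext <;> simp
  have hhalf : (x * d + d * y + y * x) / 2 ≤
      volume.real (S ∩ {z : ℂ | 0 * z.re + (-1) * z.im < 0}) := by
    rw [volumeReal_cut (S := S ∩ _) (hf _ Set.inter_subset_left) (isOpen_halfPlane 1 0 0),
      volumeReal_cut (S := (S ∩ _) \ _) (hf _ (Set.sdiff_subset.trans Set.inter_subset_left))
        (isOpen_halfPlane 1 (-1) 0)]
    have e1 : y * x / 2 ≤ volume.real ((S ∩ {z : ℂ | 0 * z.re + (-1) * z.im < 0}) ∩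
        {z : ℂ | 1 * z.re + 0 * z.im < 0}) := by
      have : y * x / 2 = volume.real (openTriangle 0 ⟨0, y⟩ ⟨-x, 0⟩) := by
        rw [volumeReal_openTriangle]; simp [cross, abs_of_pos hx, abs_of_pos hy]
      rw [this]
      refine measureReal_mono (Set.subset_inter (Set.subset_inter
        (openTriangle_subset hS h0 h2 h1') ?_) ?_)
        (hf _ (Set.inter_subset_left.trans Set.inter_subset_left))
      all_goals
        rintro _ ⟨s, t, hs, ht, hst, rfl⟩
        simp
        positivity
    have e2 : d * y / 2 ≤ volume.real (((S ∩ {z : ℂ | 0 * z.re + (-1) * z.im < 0}) \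
        {z : ℂ | 1 * z.re + 0 * z.im < 0}) ∩ {z : ℂ | 1 * z.re + (-1) * z.im < 0}) := by
      have : d * y / 2 = volume.real (openTriangle 0 ⟨d, d⟩ ⟨0, y⟩) := by
        rw [volumeReal_openTriangle]; simp [cross, abs_of_pos hd, abs_of_pos hy]
      rw [this]
      refine measureReal_mono (Set.subset_inter (Set.subset_sdiff.2 ⟨Set.subset_inter
        (openTriangle_subset hS h0 h3 h2) ?_, Set.disjoint_left.2 ?_⟩) ?_)
        (hf _ (Set.inter_subset_left.trans (Set.sdiff_subset.trans Set.inter_subset_left)))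
      all_goals
        rintro _ ⟨s, t, hs, ht, hst, rfl⟩
        simp
        have := mul_pos hs hd
        have := mul_pos ht hy
        linarith
    have e3 : x * d / 2 ≤ volume.real (((S ∩ {z : ℂ | 0 * z.re + (-1) * z.im < 0}) \
        {z : ℂ | 1 * z.re + 0 * z.im < 0}) \ {z : ℂ | 1 * z.re + (-1) * z.im < 0}) := by
      have : x * d / 2 = volume.real (openTriangle 0 ⟨x, 0⟩ ⟨d, d⟩) := by
        rw [volumeReal_openTriangle]; simp [cross, abs_of_pos hd, abs_of_pos hx]
      rw [this]
      refine measureReal_mono (Set.subset_sdiff.2 ⟨Set.subset_sdiff.2 ⟨Set.subset_inter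
        (openTriangle_subset hS h0 h1 h3) ?_, Set.disjoint_left.2 ?_⟩, Set.disjoint_left.2 ?_⟩)
        (hf _ (Set.sdiff_subset.trans (Set.sdiff_subset.trans Set.inter_subset_left)))
      all_goals
        rintro _ ⟨s, t, hs, ht, hst, rfl⟩
        simp
        have := mul_pos hs hx
        have := mul_pos ht hd
        linarith
    linarith
  have hsymm : volume.real (S ∩ {z : ℂ | 0 * z.re + (-1) * z.im < 0}) ≤
      volume.real (S \ {z : ℂ | 0 * z.re + (-1) * z.im < 0}) := by
    have : volume.real (-(S ∩ {z : ℂ | 0 * z.re + (-1) * z.im < 0})) =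
        volume.real (S ∩ {z : ℂ | 0 * z.re + (-1) * z.im < 0}) := by
      rw [measureReal_def, Measure.measure_neg, measureReal_def]
    rw [← this]
    refine measureReal_mono ?_ (hf _ Set.sdiff_subset)
    rw [Set.inter_neg, hneg]
    rintro z ⟨hz, hz'⟩
    refine ⟨hz, ?_⟩
    simp at hz' ⊢
    linarith
  rw [area_eq_volumeReal, volumeReal_cut hfin (isOpen_halfPlane 0 (-1) 0)]
  linarith

lemma volume_rectangle (a b c d : ℝ) :
    volume (Set.Icc a b ×ℂ Set.Icc c d) = ENNReal.ofReal (b - a) * ENNReal.ofReal (d - c) := by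
  have : Set.Icc a b ×ℂ Set.Icc c d =
      Complex.measurableEquivRealProd ⁻¹' (Set.Icc a b ×ˢ Set.Icc c d) := by
    ext z; simp only [Complex.mem_reProdIm, Set.mem_preimage, Set.mem_prod]; rfl
  rw [this, Complex.volume_preserving_equiv_real_prod.measure_preimage_equiv,
    Measure.volume_eq_prod, Measure.prod_prod, Real.volume_Icc, Real.volume_Icc]

lemma convex_rectangle (a b c d : ℝ) : Convex ℝ (Set.Icc a b ×ℂ Set.Icc c d) :=
  ((convex_Icc a b).is_linear_preimage Complex.reLm.isLinear).inter
    ((convex_Icc c d).is_linear_preimage Complex.imLm.isLinear)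

lemma volume_ne_top_of_subset_rectangle {S : Set ℂ} {a b c d : ℝ}
    (h : S ⊆ Set.Icc a b ×ℂ Set.Icc c d) : volume S ≠ ⊤ :=
  measure_ne_top_of_subset h (by
    rw [volume_rectangle]; exact ENNReal.mul_ne_top ENNReal.ofReal_ne_top ENNReal.ofReal_ne_top)

lemma area_le_of_subset_triangle {S : Set ℂ}
    (h : ∀ z ∈ S, 0 ≤ z.re ∧ 0 ≤ z.im ∧ z.re + z.im ≤ 1) : area S ≤ 1 / 2 := by
  set R := Set.Icc (0 : ℝ) 1 ×ℂ Set.Icc (0 : ℝ) 1 with hR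
  have hfin : volume R ≠ ⊤ := volume_ne_top_of_subset_rectangle subset_rfl
  have hvol : volume.real R = 1 := by rw [measureReal_def, volume_rectangle]; simp
  rw [volumeReal_cut hfin (isOpen_halfPlane (-1) (-1) (-1))] at hvol
  have e1 : (1 : ℝ) / 2 ≤ volume.real (R ∩ {z : ℂ | (-1) * z.re + (-1) * z.im < -1}) := by
    have : (1 : ℝ) / 2 = volume.real (openTriangle 1 Complex.I ⟨1, 1⟩) := by
      rw [volumeReal_openTriangle]; simp [cross]
    rw [this]
    refine measureReal_mono (Set.subset_inter (openTriangle_subset (convex_rectangle _ _ _ _)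
      ?_ ?_ ?_) ?_) (measure_ne_top_of_subset Set.inter_subset_left hfin)
    · simp [Complex.mem_reProdIm]
    · simp [Complex.mem_reProdIm]
    · simp [Complex.mem_reProdIm]
    · rintro _ ⟨s, t, hs, ht, hst, rfl⟩
      simp
      linarith
  have e2 : area S ≤ volume.real (R \ {z : ℂ | (-1) * z.re + (-1) * z.im < -1}) := by
    refine measureReal_mono (fun z hz => ?_) (measure_ne_top_of_subset Set.sdiff_subset hfin)
    obtain ⟨h1, h2, h3⟩ := h z hz
    refine ⟨?_, ?_⟩
    · rw [hR, Complex.mem_reProdIm]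
      exact ⟨⟨h1, by linarith⟩, ⟨h2, by linarith⟩⟩
    · simp; linarith
  linarith

lemma area_le_of_subset_hexagon {S : Set ℂ}
    (h : ∀ z ∈ S, |z.re| ≤ 2 ∧ |z.im| ≤ 2 ∧ |z.re - z.im| ≤ 2) : area S ≤ 12 := by
  set R := Set.Icc (-2 : ℝ) 2 ×ℂ Set.Icc (-2 : ℝ) 2 with hR
  have hfin : volume R ≠ ⊤ := volume_ne_top_of_subset_rectangle subset_rfl
  have hvol : volume.real R = 16 := by
    rw [measureReal_def, volume_rectangle, ENNReal.toReal_mul, ENNReal.toReal_ofReal] <;> norm_num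
  have hf : ∀ T ⊆ R, volume T ≠ ⊤ := fun T hT => measure_ne_top_of_subset hT hfin
  rw [volumeReal_cut hfin (isOpen_halfPlane (-1) 1 (-2)),
    volumeReal_cut (S := R \ _) (hf _ Set.sdiff_subset) (isOpen_halfPlane 1 (-1) (-2))] at hvol
  have e1 : (2 : ℝ) ≤ volume.real (R ∩ {z : ℂ | (-1) * z.re + 1 * z.im < -2}) := by
    have : (2 : ℝ) = volume.real (openTriangle ⟨2, 0⟩ ⟨2, -2⟩ ⟨0, -2⟩) := by
      rw [volumeReal_openTriangle]; simp [cross]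
    rw [this]
    refine measureReal_mono (Set.subset_inter (openTriangle_subset (convex_rectangle _ _ _ _)
      ?_ ?_ ?_) ?_) (hf _ Set.inter_subset_left)
    · simp [Complex.mem_reProdIm]
    · simp [Complex.mem_reProdIm]
    · simp [Complex.mem_reProdIm]
    · rintro _ ⟨s, t, hs, ht, hst, rfl⟩
      simp
      linarith
  have e2 : (2 : ℝ) ≤ volume.real ((R \ {z : ℂ | (-1) * z.re + 1 * z.im < -2}) ∩
      {z : ℂ | 1 * z.re + (-1) * z.im < -2}) := by
    have : (2 : ℝ) = volume.real (openTriangle ⟨-2, 0⟩ ⟨-2, 2⟩ ⟨0, 2⟩) := by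
      rw [volumeReal_openTriangle]; simp [cross]
    rw [this]
    refine measureReal_mono (Set.subset_inter (Set.subset_sdiff.2 ⟨openTriangle_subset
      (convex_rectangle _ _ _ _) ?_ ?_ ?_, Set.disjoint_left.2 ?_⟩) ?_)
      (hf _ (Set.inter_subset_left.trans Set.sdiff_subset))
    · simp [Complex.mem_reProdIm]
    · simp [Complex.mem_reProdIm]
    · simp [Complex.mem_reProdIm]
    all_goals
      rintro _ ⟨s, t, hs, ht, hst, rfl⟩
      simp
      linarith
  have e3 : area S ≤ volume.real ((R \ {z : ℂ | (-1) * z.re + 1 * z.im < -2}) \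
      {z : ℂ | 1 * z.re + (-1) * z.im < -2}) := by
    refine measureReal_mono (fun z hz => ?_) (hf _ (Set.sdiff_subset.trans Set.sdiff_subset))
    obtain ⟨h1, h2, h3⟩ := h z hz
    rw [abs_le] at h1 h2 h3
    refine ⟨⟨?_, ?_⟩, ?_⟩
    · rw [hR, Complex.mem_reProdIm]
      exact ⟨h1, h2⟩
    · simp; linarith
    · simp; linarith
  linarith

lemma mem_polarBody_difference {K : Set ℂ} {w : ℂ} :
    w ∈ polarBody ((2⁻¹ : ℝ) • (K - K)) ↔
      ∀ a ∈ K, ∀ b ∈ K, w.re * (a.re - b.re) + w.im * (a.im - b.im) ≤ 2 := by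
  have key : ∀ a b : ℂ, ⟪w, (2⁻¹ : ℝ) • (a - b)⟫ =
      (w.re * (a.re - b.re) + w.im * (a.im - b.im)) / 2 := by
    intro a b
    rw [Complex.inner]
    simp
    ring
  constructor
  · intro h a ha b hb
    have := h _ (Set.smul_mem_smul_set (Set.sub_mem_sub ha hb))
    rw [key] at this
    linarith
  · rintro h _ ⟨_, ⟨a, ha, b, hb, rfl⟩, rfl⟩
    have := h a ha b hb
    simp only [key]
    linarith

lemma neg_polarBody_difference (K : Set ℂ) :
    -polarBody ((2⁻¹ : ℝ) • (K - K)) = polarBody ((2⁻¹ : ℝ) • (K - K)) := by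
  ext w
  rw [Set.mem_neg, mem_polarBody_difference, mem_polarBody_difference]
  constructor <;>
  · intro h a ha b hb
    have := h b hb a ha
    simp at this ⊢
    linarith

lemma mem_convexHull_std {z : ℂ} :
    z ∈ convexHull ℝ {0, 1, Complex.I} ↔ 0 ≤ z.re ∧ 0 ≤ z.im ∧ z.re + z.im ≤ 1 := by
  constructor
  · intro h
    have hc : Convex ℝ {z : ℂ | 0 ≤ z.re ∧ 0 ≤ z.im ∧ z.re + z.im ≤ 1} := by
      rintro x ⟨h1, h2, h3⟩ y ⟨h4, h5, h6⟩ a b ha hb hab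
      refine ⟨?_, ?_, ?_⟩ <;> simp
      · positivity
      · positivity
      · nlinarith
    refine convexHull_min ?_ hc h
    rintro x (rfl | rfl | rfl) <;> simp
  · rintro ⟨h1, h2, h3⟩
    have hc := convex_convexHull ℝ ({0, 1, Complex.I} : Set ℂ)
    have := hc.sum_mem (t := Finset.univ) (w := ![1 - z.re - z.im, z.re, z.im])
      (z := ![0, 1, Complex.I])
      (by intro i _; fin_cases i <;> simp <;> linarith)
      (by simp [Fin.sum_univ_three]; ring)
      (by intro i _; fin_cases i <;> exact subset_convexHull _ _ (by simp))
    convert this using 1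
    apply Complex.ext <;> simp [Fin.sum_univ_three]

lemma area_mul_area_polarBody_std_le :
    area (convexHull ℝ {0, 1, Complex.I}) *
      area (polarBody ((2⁻¹ : ℝ) • (convexHull ℝ {0, 1, Complex.I} -
        convexHull ℝ {0, 1, Complex.I}))) ≤ 6 := by
  have h1 := area_le_of_subset_triangle (S := convexHull ℝ {0, 1, Complex.I})
    fun z hz => mem_convexHull_std.1 hz
  have h2 := area_le_of_subset_hexagon (S := polarBody ((2⁻¹ : ℝ) •
      (convexHull ℝ {0, 1, Complex.I} - convexHull ℝ {0, 1, Complex.I}))) (by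
    intro z hz
    rw [mem_polarBody_difference] at hz
    have m0 : (0 : ℂ) ∈ convexHull ℝ {0, 1, Complex.I} := subset_convexHull _ _ (by simp)
    have m1 : (1 : ℂ) ∈ convexHull ℝ {0, 1, Complex.I} := subset_convexHull _ _ (by simp)
    have mI : Complex.I ∈ convexHull ℝ {0, 1, Complex.I} := subset_convexHull _ _ (by simp)
    have := hz _ m0 _ m1
    have := hz _ m1 _ m0
    have := hz _ m0 _ mI
    have := hz _ mI _ m0
    have := hz _ m1 _ mI
    have := hz _ mI _ m1
    simp at *
    refine ⟨abs_le.2 ⟨?_, ?_⟩, abs_le.2 ⟨?_, ?_⟩, abs_le.2 ⟨?_, ?_⟩⟩ <;> linarith)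
  calc _ ≤ (1 / 2 : ℝ) * 12 := by
        gcongr
        exact ENNReal.toReal_nonneg
    _ = 6 := by norm_num

lemma three_mul_prod_le {a b c : ℝ} (ha : 0 ≤ a) (hb : 0 ≤ b) (hc : 0 ≤ c) :
    3 * ((1 + a) * (1 + b) * (1 + c)) +
      (3 + a + b + c) * ((a + b + c) * (3 - (a + b + c))) / 9 ≤
        (1 + a + b + c) * (3 + a + b + c) := by
  have amgm : 27 * ((1 + a) * (1 + b) * (1 + c)) ≤ (3 + a + b + c) ^ 3 := by
    nlinarith [mul_nonneg (by linarith : 0 ≤ 1 + a) (sq_nonneg (b - c)),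
      mul_nonneg (by linarith : 0 ≤ 1 + b) (sq_nonneg (a - c)),
      mul_nonneg (by linarith : 0 ≤ 1 + c) (sq_nonneg (a - b)),
      mul_nonneg (by linarith : 0 ≤ 3 + a + b + c) (sq_nonneg (a - b)),
      mul_nonneg (by linarith : 0 ≤ 3 + a + b + c) (sq_nonneg (a - c)),
      mul_nonneg (by linarith : 0 ≤ 3 + a + b + c) (sq_nonneg (b - c))]
  nlinarith

/-- A convex body in which the triangle `0`, `1`, `I` is an inscribed triangle of maximal area. -/
structure IsNormalized (K : Set ℂ) : Prop where
  convex : Convex ℝ K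
  isClosed : IsClosed K
  zero_mem : (0 : ℂ) ∈ K
  one_mem : (1 : ℂ) ∈ K
  I_mem : Complex.I ∈ K
  abs_cross_le : ∀ a ∈ K, ∀ b ∈ K, ∀ c ∈ K, |cross (b - a) (c - a)| ≤ 1

namespace IsNormalized

variable {K : Set ℂ}

lemma abs_re_le (hK : IsNormalized K) {z : ℂ} (hz : z ∈ K) : |z.re| ≤ 1 := by
  have := hK.abs_cross_le _ hK.zero_mem _ hz _ hK.I_mem
  simpa [cross] using this

lemma abs_im_le (hK : IsNormalized K) {z : ℂ} (hz : z ∈ K) : |z.im| ≤ 1 := by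
  have := hK.abs_cross_le _ hK.zero_mem _ hK.one_mem _ hz
  simpa [cross] using this

lemma re_add_im_mem (hK : IsNormalized K) {z : ℂ} (hz : z ∈ K) :
    0 ≤ z.re + z.im ∧ z.re + z.im ≤ 2 := by
  have := hK.abs_cross_le _ hK.one_mem _ hK.I_mem _ hz
  simp [cross, abs_le] at this
  constructor <;> linarith

lemma subset_rectangle (hK : IsNormalized K) : K ⊆ Set.Icc (-1) 1 ×ℂ Set.Icc (-1) 1 := by
  intro z hz
  rw [Complex.mem_reProdIm]
  exact ⟨abs_le.1 (hK.abs_re_le hz), abs_le.1 (hK.abs_im_le hz)⟩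

lemma isCompact (hK : IsNormalized K) : IsCompact K :=
  (isCompact_Icc.reProdIm isCompact_Icc).of_isClosed_subset hK.isClosed hK.subset_rectangle

lemma volume_polarBody_ne_top (hK : IsNormalized K) :
    volume (polarBody ((2⁻¹ : ℝ) • (K - K))) ≠ ⊤ := by
  refine volume_ne_top_of_subset_rectangle (a := -2) (b := 2) (c := -2) (d := 2) fun z hz => ?_
  rw [mem_polarBody_difference] at hz
  have := hz _ hK.zero_mem _ hK.one_mem
  have := hz _ hK.one_mem _ hK.zero_mem
  have := hz _ hK.zero_mem _ hK.I_mem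
  have := hz _ hK.I_mem _ hK.zero_mem
  rw [Complex.mem_reProdIm]
  simp at *
  refine ⟨⟨?_, ?_⟩, ⟨?_, ?_⟩⟩ <;> linarith

/-- The inequality for a normalized body, with the equality case. -/
lemma six_le (hK : IsNormalized K) :
    6 ≤ area K * area (polarBody ((2⁻¹ : ℝ) • (K - K))) ∧
      (area K * area (polarBody ((2⁻¹ : ℝ) • (K - K))) = 6 →
        K = convexHull ℝ {0, 1, Complex.I}) := by
  obtain ⟨u, hu, hu'⟩ := hK.isCompact.exists_isMinOn ⟨0, hK.zero_mem⟩
    Complex.continuous_re.continuousOn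
  obtain ⟨v, hv, hv'⟩ := hK.isCompact.exists_isMinOn ⟨0, hK.zero_mem⟩
    Complex.continuous_im.continuousOn
  obtain ⟨w, hw, hw'⟩ := hK.isCompact.exists_isMaxOn ⟨0, hK.zero_mem⟩
    (Complex.continuous_re.add Complex.continuous_im).continuousOn
  rw [isMinOn_iff] at hu' hv'
  replace hw' : ∀ z ∈ K, z.re + z.im ≤ w.re + w.im := isMaxOn_iff.1 hw'
  have hu0 : u.re ≤ 0 := by simpa using hu' 0 hK.zero_mem
  have hv0 : v.im ≤ 0 := by simpa using hv' 0 hK.zero_mem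
  have hw0 : 1 ≤ w.re + w.im := by simpa using hw' 1 hK.one_mem
  have hu1 := abs_le.1 (hK.abs_re_le hu)
  have hu2 := abs_le.1 (hK.abs_im_le hu)
  have hu3 := hK.re_add_im_mem hu
  have hv1 := abs_le.1 (hK.abs_im_le hv)
  have hv2 := abs_le.1 (hK.abs_re_le hv)
  have hv3 := hK.re_add_im_mem hv
  have hw1 := abs_le.1 (hK.abs_re_le hw)
  have hw2 := abs_le.1 (hK.abs_im_le hw)
  have hw3 := hK.re_add_im_mem hw
  obtain ⟨a, ha⟩ : ∃ a, a = -u.re := ⟨_, rfl⟩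
  obtain ⟨b, hb⟩ : ∃ b, b = -v.im := ⟨_, rfl⟩
  obtain ⟨c, hc⟩ : ∃ c, c = w.re + w.im - 1 := ⟨_, rfl⟩
  have ha0 : 0 ≤ a := by linarith
  have hb0 : 0 ≤ b := by linarith
  have hc0 : 0 ≤ c := by linarith
  have hareaK := area_ge_of_caps hK.convex
    (volume_ne_top_of_subset_rectangle hK.subset_rectangle) hK.zero_mem hK.one_mem hK.I_mem
    hu hv hw hu0 hv0 hv3.1 hw1.2 hw2.2 hw0
  have hareaP := area_ge_of_hexagon (convex_polarBody _) hK.volume_polarBody_ne_top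
    (neg_polarBody_difference K) (x := 2 / (1 + a)) (y := 2 / (1 + b)) (d := 2 / (1 + c))
    (by positivity) (by positivity) (by positivity)
    (by
      rw [mem_polarBody_difference]
      intro p hp q hq
      have := hu' q hq
      have := (abs_le.1 (hK.abs_re_le hp)).2
      simp only [zero_mul, add_zero]
      rw [div_mul_eq_mul_div, div_le_iff₀ (by positivity)]
      linarith)
    (by
      rw [mem_polarBody_difference]
      intro p hp q hq
      have := hv' q hq
      have := (abs_le.1 (hK.abs_im_le hp)).2
      simp only [zero_mul, zero_add]
      rw [div_mul_eq_mul_div, div_le_iff₀ (by positivity)]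
      linarith)
    (by
      rw [mem_polarBody_difference]
      intro p hp q hq
      have := hw' p hp
      have := (hK.re_add_im_mem hq).1
      simp only [← mul_add]
      rw [div_mul_eq_mul_div, div_le_iff₀ (by positivity)]
      linarith)
  have hkey := three_mul_prod_le ha0 hb0 hc0
  have hS0 : 0 ≤ (a + b + c) * (3 - (a + b + c)) :=
    mul_nonneg (by positivity) (by linarith)
  have hprod : (1 + a + b + c) / 2 *
      (4 * (3 + a + b + c) / ((1 + a) * (1 + b) * (1 + c))) ≤
        area K * area (polarBody ((2⁻¹ : ℝ) • (K - K))) := by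
    refine mul_le_mul (by linarith) (le_trans (le_of_eq ?_) hareaP) (by positivity)
      ENNReal.toReal_nonneg
    field_simp
    ring
  have hD : 0 < (1 + a) * (1 + b) * (1 + c) := by positivity
  rw [show (1 + a + b + c) / 2 * (4 * (3 + a + b + c) / ((1 + a) * (1 + b) * (1 + c))) =
    2 * ((1 + a + b + c) * (3 + a + b + c)) / ((1 + a) * (1 + b) * (1 + c)) by
      field_simp; ring, div_le_iff₀ hD] at hprod
  have hS1 : 0 ≤ (3 + a + b + c) * ((a + b + c) * (3 - (a + b + c))) / 9 := by positivity
  refine ⟨le_of_mul_le_mul_right (by linarith) hD, fun heq => ?_⟩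
  rw [heq] at hprod
  have hS : (a + b + c) * (3 - (a + b + c)) = 0 := by
    have : 0 < 3 + a + b + c := by positivity
    nlinarith
  rcases mul_eq_zero.1 hS with hS | hS
  · refine Set.Subset.antisymm (fun z hz => ?_) (convexHull_min ?_ hK.convex)
    · rw [mem_convexHull_std]
      have := hu' z hz
      have := hv' z hz
      have := hw' z hz
      refine ⟨?_, ?_, ?_⟩ <;> linarith
    · rintro z (rfl | rfl | rfl)
      exacts [hK.zero_mem, hK.one_mem, hK.I_mem]
  · have hcr := hK.abs_cross_le u hu v hv w hw
    have e1 : u.re = -1 := by linarith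
    have e2 : u.im = 1 := by linarith
    have e3 : v.im = -1 := by linarith
    have e4 : v.re = 1 := by linarith
    have e5 : w.re = 1 := by linarith
    have e6 : w.im = 1 := by linarith
    norm_num [cross, e1, e2, e3, e4, e5, e6] at hcr

end IsNormalized

lemma frameMap_surjective {u v : ℂ} (h : cross u v ≠ 0) : Function.Surjective (frameMap u v) := by
  intro w
  refine ⟨⟨cross w v / cross u v, cross u w / cross u v⟩, ?_⟩
  apply Complex.ext <;> simp only [frameMap_apply, Complex.add_re, Complex.add_im,
    Complex.smul_re, Complex.smul_im, smul_eq_mul] <;> field_simp <;> unfold cross <;> ring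

lemma frameAffine_surjective {p q r : ℂ} (h : cross (q - p) (r - p) ≠ 0) :
    Function.Surjective (frameAffine p q r) := by
  intro w
  obtain ⟨z, hz⟩ := frameMap_surjective h (w - p)
  exact ⟨z, by rw [frameAffine_apply, hz, sub_add_cancel]⟩

lemma frameAffine_zero (p q r : ℂ) : frameAffine p q r 0 = p := by
  simp [frameAffine_apply]

lemma frameAffine_one (p q r : ℂ) : frameAffine p q r 1 = q := by
  simp [frameAffine_apply, frameMap_apply]

lemma frameAffine_I (p q r : ℂ) : frameAffine p q r Complex.I = r := by
  simp [frameAffine_apply, frameMap_apply]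

lemma image_frameAffine_convexHull (p q r : ℂ) :
    frameAffine p q r '' convexHull ℝ {0, 1, Complex.I} = convexHull ℝ {p, q, r} := by
  rw [AffineMap.image_convexHull, Set.image_insert_eq, Set.image_pair, frameAffine_zero,
    frameAffine_one, frameAffine_I]

lemma linearIndependent_iff_cross_ne_zero {u v : ℂ} :
    LinearIndependent ℝ ![u, v] ↔ cross u v ≠ 0 := by
  rw [LinearIndependent.pair_iff]
  constructor
  · intro h hc
    have h1 := h v.re (-u.re) (by
      unfold cross at hc
      apply Complex.ext <;> simp <;> linarith)
    have h2 := h v.im (-u.im) (by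
      unfold cross at hc
      apply Complex.ext <;> simp <;> linarith)
    have hu : u = 0 := Complex.ext (by simpa using h1.2) (by simpa using h2.2)
    simpa using h 1 0 (by simp [hu])
  · intro h s t hst
    have hre := congrArg Complex.re hst
    have him := congrArg Complex.im hst
    simp at hre him
    constructor
    · refine (mul_eq_zero.1 (?_ : s * cross u v = 0)).resolve_right h
      unfold cross
      linear_combination v.im * hre - v.re * him
    · refine (mul_eq_zero.1 (?_ : t * cross u v = 0)).resolve_right h
      unfold cross
      linear_combination u.re * him - u.im * hre

lemma affineIndependent_iff_cross_ne_zero {p q r : ℂ} :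
    AffineIndependent ℝ ![p, q, r] ↔ cross (q - p) (r - p) ≠ 0 := by
  rw [affineIndependent_iff_linearIndependent_vsub ℝ _ (0 : Fin 3),
    ← linearIndependent_equiv (finSuccAboveEquiv (0 : Fin 3)),
    ← linearIndependent_iff_cross_ne_zero]
  convert! Iff.rfl
  ext i
  fin_cases i <;> rfl

/-- The product of the two areas is invariant under nondegenerate affine maps. -/
lemma area_mul_area_image {p q r : ℂ} (h : cross (q - p) (r - p) ≠ 0) (K : Set ℂ) :
    area (frameAffine p q r '' K) *
      area (polarBody ((2⁻¹ : ℝ) • (frameAffine p q r '' K - frameAffine p q r '' K))) =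
    area K * area (polarBody ((2⁻¹ : ℝ) • (K - K))) := by
  set u := q - p
  set v := r - p
  have h1 : area (frameAffine p q r '' K) = |cross u v| * area K := by
    have : frameAffine p q r '' K = p +ᵥ (frameMap u v '' K) := by
      ext z
      simp [Set.mem_vadd_set, frameAffine_apply, add_comm, u, v]
    rw [this, area, measure_vadd, Measure.addHaar_image_linearMap, det_frameMap,
      ENNReal.toReal_mul, ENNReal.toReal_ofReal (abs_nonneg _), area]
  have h2 : polarBody ((2⁻¹ : ℝ) • (frameAffine p q r '' K - frameAffine p q r '' K)) =
      frameMap ⟨u.re, v.re⟩ ⟨u.im, v.im⟩ ⁻¹' polarBody ((2⁻¹ : ℝ) • (K - K)) := by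
    ext w
    rw [Set.mem_preimage, mem_polarBody_difference, mem_polarBody_difference]
    simp only [Set.forall_mem_image]
    refine forall₄_congr fun a _ b _ => ?_
    refine iff_of_eq (congrArg (· ≤ 2) ?_)
    simp [frameAffine_apply, frameMap_apply, u, v]
    ring
  have h3 : cross ⟨u.re, v.re⟩ ⟨u.im, v.im⟩ = cross u v := by simp [cross]; ring
  rw [h1, h2, area, area, area, Measure.addHaar_preimage_linearMap _
    (by rwa [det_frameMap, h3]), det_frameMap, h3, ENNReal.toReal_mul,
    ENNReal.toReal_ofReal (abs_nonneg _), abs_inv]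
  have := abs_pos.2 h
  field_simp

lemma exists_maximal_triangle {K : Set ℂ} (hK : IsConvexBody K) :
    ∃ p ∈ K, ∃ q ∈ K, ∃ r ∈ K, cross (q - p) (r - p) ≠ 0 ∧
      ∀ a ∈ K, ∀ b ∈ K, ∀ c ∈ K, |cross (b - a) (c - a)| ≤ |cross (q - p) (r - p)| := by
  obtain ⟨-, hcomp, x, hx⟩ := hK
  obtain ⟨ε, hε, hball⟩ := Metric.mem_nhds_iff.1 (mem_interior_iff_mem_nhds.1 hx)
  have m0 : x ∈ K := hball (Metric.mem_ball_self hε)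
  have m1 : x + ((ε / 2 : ℝ) : ℂ) ∈ K := hball (by
    rw [Metric.mem_ball, dist_eq_norm, add_sub_cancel_left, Complex.norm_real, Real.norm_eq_abs,
      abs_of_pos (by positivity)]
    linarith)
  have m2 : x + ((ε / 2 : ℝ) : ℂ) * Complex.I ∈ K := hball (by
    rw [Metric.mem_ball, dist_eq_norm, add_sub_cancel_left, norm_mul, Complex.norm_I,
      Complex.norm_real, Real.norm_eq_abs, abs_of_pos (by positivity)]
    linarith)
  have hcont : Continuous fun t : ℂ × ℂ × ℂ => |cross (t.2.1 - t.1) (t.2.2 - t.1)| := by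
    unfold cross; fun_prop
  obtain ⟨⟨p, q, r⟩, ⟨hp, hq, hr⟩, hmax⟩ :=
    (hcomp.prod (hcomp.prod hcomp)).exists_isMaxOn ⟨(x, x, x), m0, m0, m0⟩ hcont.continuousOn
  rw [isMaxOn_iff] at hmax
  refine ⟨p, hp, q, hq, r, hr, ?_, fun a ha b hb c hc => hmax (a, b, c) ⟨ha, hb, hc⟩⟩
  have := hmax (_, _, _) ⟨m0, m1, m2⟩
  refine abs_pos.1 (lt_of_lt_of_le ?_ this)
  simp [cross]
  positivity

lemma isNormalized_preimage {K : Set ℂ} (hK : IsConvexBody K) {p q r : ℂ} (hp : p ∈ K)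
    (hq : q ∈ K) (hr : r ∈ K) (hpqr : cross (q - p) (r - p) ≠ 0)
    (hmax : ∀ a ∈ K, ∀ b ∈ K, ∀ c ∈ K, |cross (b - a) (c - a)| ≤ |cross (q - p) (r - p)|) :
    IsNormalized (frameAffine p q r ⁻¹' K) where
  convex := hK.1.affine_preimage _
  isClosed := hK.2.1.isClosed.preimage (AffineMap.continuous_of_finiteDimensional _)
  zero_mem := by rwa [Set.mem_preimage, frameAffine_zero]
  one_mem := by rwa [Set.mem_preimage, frameAffine_one]
  I_mem := by rwa [Set.mem_preimage, frameAffine_I]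
  abs_cross_le a ha b hb c hc := by
    have := hmax _ ha _ hb _ hc
    rw [frameAffine_apply, frameAffine_apply, frameAffine_apply, add_sub_add_right_eq_sub,
      add_sub_add_right_eq_sub, ← map_sub, ← map_sub, cross_frameMap, abs_mul] at this
    exact le_of_mul_le_mul_left (by linarith) (abs_pos.2 hpqr)

/-- Eggleston: for a planar convex body `K`, `|K|·|((K−K)/2)*| ≥ 6`,
with equality iff `K` is a triangle.  Here `K − K` is the difference body. -/
theorem eggleston (K : Set ℂ) (hK : IsConvexBody K) :
    6 ≤ area K * area (polarBody ((2⁻¹ : ℝ) • (K - K))) ∧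
      (area K * area (polarBody ((2⁻¹ : ℝ) • (K - K))) = 6 ↔ IsTriangle K) := by
  obtain ⟨p, hp, q, hq, r, hr, hpqr, hmax⟩ := exists_maximal_triangle hK
  have himage := Set.image_preimage_eq K (frameAffine_surjective hpqr)
  have hprod := area_mul_area_image hpqr (frameAffine p q r ⁻¹' K)
  rw [himage] at hprod
  obtain ⟨h6, heq⟩ := (isNormalized_preimage hK hp hq hr hpqr hmax).six_le
  rw [← hprod] at h6 heq
  refine ⟨h6, fun h => ⟨p, q, r, affineIndependent_iff_cross_ne_zero.2 hpqr, ?_⟩, ?_⟩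
  · rw [← himage, heq h, image_frameAffine_convexHull]
  · rintro ⟨a, b, c, habc, rfl⟩
    refine le_antisymm ?_ h6
    rw [← image_frameAffine_convexHull,
      area_mul_area_image (affineIndependent_iff_cross_ne_zero.1 habc)]
    exact area_mul_area_polarBody_std_le
end
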